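/- arXiv:2012.07276 — 13 statements merged into one kernel-verified Lean document; each statement's English description precedes it below -/
import Mathlib

section
/- Let G be a group and n ≥ 1. A subset A ⊆ G is n-syndetic if and only if there exists a finite subset F ⊆ G such that for every partition of F into n (possibly empty) pieces F = F₁ ⊔ ⋯ ⊔ Fₙ there exists an index i with Fᵢ·A = G, where Fᵢ·A = {f·a : f ∈ Fᵢ, a ∈ A}. -/
/-- A subset `A` of a group `G` is `n`-syndetic if there is a finite set `F ⊆ G` such that
`⋃_{f ∈ F} f·Aⁿ = Gⁿ`, where `G` acts diagonally on `Gⁿ`. -/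
def IsNSyndetic {G : Type*} [Group G] (n : ℕ) (A : Set G) : Prop :=
  ∃ F : Finset G, ∀ x : Fin n → G, ∃ f ∈ F, ∀ i, f⁻¹ * x i ∈ A

/-- `A` is `n`-syndetic iff there is a finite `F ⊆ G` such that for every partition of `F`
into `n` (possibly empty) pieces `F = F₁ ⊔ ⋯ ⊔ Fₙ` (encoded by a colouring `c : G → Fin n`,
with `Fᵢ = {f ∈ F : c f = i}`), some piece satisfies `Fᵢ·A = G`. -/
theorem nSyndetic_iff_partition {G : Type*} [Group G] (n : ℕ) (hn : 1 ≤ n) (A : Set G) :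
    IsNSyndetic n A ↔
      ∃ F : Finset G, ∀ c : G → Fin n, ∃ i : Fin n,
        ∀ g : G, ∃ f ∈ F, c f = i ∧ f⁻¹ * g ∈ A := by
  refine exists_congr fun F => ⟨fun h c => ?_, fun h x => ?_⟩
  · by_contra! hc
    choose x hx using hc
    obtain ⟨f, hf, hfx⟩ := h x
    exact hx (c f) f hf rfl (hfx (c f))
  · by_contra! hx
    have hcol : ∀ f : G, ∃ i : Fin n, f ∈ F → f⁻¹ * x i ∉ A := by
      intro f
      by_cases hf : f ∈ F
      · obtain ⟨i, hi⟩ := hx f hf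
        exact ⟨i, fun _ => hi⟩
      · exact ⟨⟨0, hn⟩, fun h' => absurd h' hf⟩
    choose c hc using hcol
    obtain ⟨i, hi⟩ := h c
    obtain ⟨f, hf, rfl, hA⟩ := hi (x i)
    exact hc f hf hA
end

section
/- Let G be a group and n ≥ 1. A subset B ⊆ G satisfies A ∩ B ≠ ∅ for every n-syndetic subset A ⊆ G if and only if B is 1/n-thick. Consequently, B satisfies A ∩ B ≠ ∅ for every completely syndetic subset A ⊆ G if and only if B is fractionally thick. -/
/-- `A` is completely syndetic if it is `n`-syndetic for every `n ≥ 1`. -/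
def CompletelySyndetic {G : Type*} [Group G] (A : Set G) : Prop :=
  ∀ n : ℕ, 1 ≤ n → IsNSyndetic n A

/-- A subset `B` of a group `G` is `1/n`-thick if for every finite `F ⊆ G` there is
`(h₁, …, hₙ) ∈ Gⁿ` such that every `f ∈ F` satisfies `f * hᵢ ∈ B` for some `i`. -/
def OneOverNThick {G : Type*} [Group G] (n : ℕ) (B : Set G) : Prop :=
  ∀ F : Finset G, ∃ h : Fin n → G, ∀ f ∈ F, ∃ i : Fin n, f * h i ∈ B

/-- `B` is fractionally thick if it is `1/n`-thick for some `n ≥ 1`. -/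
def FractionallyThick {G : Type*} [Group G] (B : Set G) : Prop :=
  ∃ n : ℕ, 1 ≤ n ∧ OneOverNThick n B

theorem IsNSyndetic.mono {G : Type*} [Group G] {n : ℕ} {A A' : Set G} (hA : IsNSyndetic n A)
    (h : A ⊆ A') : IsNSyndetic n A' := by
  obtain ⟨F, hF⟩ := hA
  refine ⟨F, fun x => ?_⟩
  obtain ⟨f, hf, hx⟩ := hF x
  exact ⟨f, hf, fun i => h (hx i)⟩

theorem isNSyndetic_compl_iff {G : Type*} [Group G] {n : ℕ} {B : Set G} :
    IsNSyndetic n Bᶜ ↔ ¬ OneOverNThick n B := by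
  simp only [IsNSyndetic, OneOverNThick, not_forall, not_exists, exists_prop, Set.mem_compl_iff]
  constructor
  · rintro ⟨F, hF⟩
    refine ⟨F.map (Equiv.inv G).toEmbedding, fun x => ?_⟩
    obtain ⟨f, hf, hx⟩ := hF x
    exact ⟨f⁻¹, Finset.mem_map_of_mem _ hf, hx⟩
  · rintro ⟨F, hF⟩
    refine ⟨F.map (Equiv.inv G).toEmbedding, fun x => ?_⟩
    obtain ⟨f, hf, hx⟩ := hF x
    exact ⟨f⁻¹, Finset.mem_map_of_mem _ hf, by simpa using hx⟩

theorem completelySyndetic_compl_iff {G : Type*} [Group G] {B : Set G} :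
    CompletelySyndetic Bᶜ ↔ ¬ FractionallyThick B := by
  simp only [CompletelySyndetic, FractionallyThick, isNSyndetic_compl_iff, not_exists, not_and]

/-- For an upward closed family `P` of sets, a set meets every member of `P` if and only if its
complement is not in `P`. -/
theorem forall_inter_nonempty_iff_not_compl {α : Type*} {P : Set α → Prop}
    (hP : ∀ A A' : Set α, A ⊆ A' → P A → P A') (B : Set α) :
    (∀ A : Set α, P A → (A ∩ B).Nonempty) ↔ ¬ P Bᶜ := by
  refine ⟨fun h hB => by simpa using h Bᶜ hB, fun h A hA => ?_⟩
  by_contra hAB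
  rw [Set.not_nonempty_iff_eq_empty, ← Set.disjoint_iff_inter_eq_empty] at hAB
  exact h (hP A Bᶜ hAB.subset_compl_right hA)

theorem dual_family_nSyndetic {G : Type*} [Group G] (n : ℕ) (hn : 1 ≤ n) (B : Set G) :
    ((∀ A : Set G, IsNSyndetic n A → (A ∩ B).Nonempty) ↔ OneOverNThick n B) ∧
      ((∀ A : Set G, CompletelySyndetic A → (A ∩ B).Nonempty) ↔ FractionallyThick B) := by
  constructor
  · rw [forall_inter_nonempty_iff_not_compl (fun _ _ h hA => hA.mono h), isNSyndetic_compl_iff,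
      not_not]
  · rw [forall_inter_nonempty_iff_not_compl (fun _ _ h hA m hm => (hA m hm).mono h),
      completelySyndetic_compl_iff, not_not]
end

section
/- Let G be an infinite group, F ⊆ G a finite subset, and n ≥ 1. (i) If (K, k) is an (F, n)-coloring of G, then the set A = ⋃_{E ⊆ G, |E| = n} k(E)·E is n-syndetic and satisfies (F·A) ∩ A = ∅. (ii) Conversely, if A ⊆ G is n-syndetic and satisfies (F·A) ∩ A = ∅, then there exists an (F, n)-coloring (K, k) of G such that ⋃_{E ⊆ G, |E| = n} k(E)·E ⊆ A. -/
/-- An `(F, n)`-coloring of `G` is a pair `(K, k)` consisting of a finite set `K ⊆ G` and a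
function `k` assigning to each subset `E ⊆ G` with `|E| = n` an element of `K`, such that
for any two such subsets `E₁, E₂` one has `(F·k(E₁)·E₁) ∩ (k(E₂)·E₂) = ∅`. -/
def IsFnColoring {G : Type*} [Group G] (F : Finset G) (n : ℕ) (K : Finset G)
    (k : Finset G → G) : Prop :=
  (∀ E : Finset G, E.card = n → k E ∈ K) ∧
  ∀ E₁ E₂ : Finset G, E₁.card = n → E₂.card = n →
    {x : G | ∃ f ∈ F, ∃ e ∈ E₁, x = f * (k E₁ * e)} ∩
      {x : G | ∃ e ∈ E₂, x = k E₂ * e} = ∅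

theorem coloring_correspondence {G : Type*} [Group G] [Infinite G] (F : Finset G)
    (n : ℕ) (hn : 1 ≤ n) :
    (∀ (K : Finset G) (k : Finset G → G), IsFnColoring F n K k →
      IsNSyndetic n {x : G | ∃ E : Finset G, E.card = n ∧ ∃ e ∈ E, x = k E * e} ∧
        {x : G | ∃ f ∈ F, ∃ a ∈ {y : G | ∃ E : Finset G, E.card = n ∧ ∃ e ∈ E, y = k E * e},
            x = f * a} ∩
          {x : G | ∃ E : Finset G, E.card = n ∧ ∃ e ∈ E, x = k E * e} = ∅) ∧
    (∀ A : Set G, IsNSyndetic n A →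
      {x : G | ∃ f ∈ F, ∃ a ∈ A, x = f * a} ∩ A = ∅ →
      ∃ (K : Finset G) (k : Finset G → G), IsFnColoring F n K k ∧
        {x : G | ∃ E : Finset G, E.card = n ∧ ∃ e ∈ E, x = k E * e} ⊆ A) := by
  classical
  refine ⟨fun K k hk => ⟨⟨K.image (·⁻¹), fun x => ?_⟩, ?_⟩, fun A hA hFA => ?_⟩
  · obtain ⟨E, hxE, hE⟩ := Infinite.exists_superset_card_eq (Finset.univ.image x) n
      (Finset.card_image_le.trans (by simp))
    refine ⟨(k E)⁻¹, Finset.mem_image_of_mem _ (hk.1 E hE), fun i => ⟨E, hE, x i, ?_, ?_⟩⟩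
    · exact hxE (Finset.mem_image_of_mem x (Finset.mem_univ i))
    · rw [inv_inv]
  · rw [Set.eq_empty_iff_forall_notMem]
    rintro _ ⟨⟨f, hf, _, ⟨E₁, hE₁, e₁, he₁, rfl⟩, rfl⟩, E₂, hE₂, e₂, he₂, h⟩
    exact Set.eq_empty_iff_forall_notMem.1 (hk.2 E₁ E₂ hE₁ hE₂) _
      ⟨⟨f, hf, e₁, he₁, rfl⟩, e₂, he₂, h⟩
  · obtain ⟨S, hS⟩ := hA
    have hex : ∀ E : Finset G, ∃ g : G, E.card = n → g ∈ S.image (·⁻¹) ∧ ∀ e ∈ E, g * e ∈ A := by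
      intro E
      by_cases hE : E.card = n
      · obtain ⟨f, hf, hfA⟩ := hS fun i => ((E.equivFinOfCardEq hE).symm i : G)
        refine ⟨f⁻¹, fun _ => ⟨Finset.mem_image_of_mem _ hf, fun e he => ?_⟩⟩
        simpa using hfA (E.equivFinOfCardEq hE ⟨e, he⟩)
      · exact ⟨1, fun h => absurd h hE⟩
    choose k hk using hex
    refine ⟨S.image (·⁻¹), k, ⟨fun E hE => (hk E hE).1, fun E₁ E₂ hE₁ hE₂ => ?_⟩, ?_⟩
    · rw [Set.eq_empty_iff_forall_notMem]
      rintro _ ⟨⟨f, hf, e₁, he₁, rfl⟩, e₂, he₂, h⟩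
      exact Set.eq_empty_iff_forall_notMem.1 hFA _
        ⟨⟨f, hf, _, (hk E₁ hE₁).2 e₁ he₁, rfl⟩, h ▸ (hk E₂ hE₂).2 e₂ he₂⟩
    · rintro _ ⟨E, hE, e, he, rfl⟩
      exact (hk E hE).2 e he
end

section
/- Let G be a group and n ≥ 1. A subset A ⊆ G is n-syndetic if and only if for every finite set S of ultrafilters on G with |S| ≤ n there exists g ∈ G such that for every ultrafilter 𝒰 ∈ S the set {h ∈ G : g·h ∈ A} belongs to 𝒰. -/
/-- A nonempty finite set with at most `n` elements is the range of a family indexed by `Fin n`. -/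
theorem Finset.exists_fin_range_eq_of_card_le {α : Type*} {S : Finset α} (hS : S.Nonempty)
    {n : ℕ} (hn : S.card ≤ n) : ∃ u : Fin n → α, Set.range u = S := by
  have := hS.to_subtype
  obtain ⟨e⟩ : Nonempty (S ↪ Fin n) := Function.Embedding.nonempty_of_card_le (by simpa using hn)
  refine ⟨fun i ↦ (Function.invFun e i : S), ?_⟩
  have h := (Function.invFun_surjective e.injective).range_comp (Subtype.val : S → α)
  exact h.trans Subtype.range_coe

/-- If finitely many sets `B f` (`f ∈ F`) are given, some point lies in only those among them
which belong to the ultrafilter `U`. -/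
theorem Ultrafilter.exists_forall_mem_imp_mem {α ι : Type*} (U : Ultrafilter α) (F : Finset ι)
    (B : ι → Set α) : ∃ x, ∀ f ∈ F, x ∈ B f → B f ∈ U := by
  have h : ∀ᶠ x in (U : Filter α), ∀ f ∈ F, x ∈ B f → B f ∈ U := by
    rw [Filter.eventually_all_finset]
    intro f _
    by_cases hf : B f ∈ U
    · exact Filter.Eventually.of_forall fun _ _ ↦ hf
    · filter_upwards [Ultrafilter.compl_mem_iff_notMem.2 hf] with x hx hxf
      exact absurd hxf hx
  exact h.exists

/-- A translate of an `n`-syndetic set has any given `n` ultrafilters in its closure. -/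
theorem IsNSyndetic.exists_forall_mem {G : Type*} [Group G] {n : ℕ} {A : Set G}
    (hA : IsNSyndetic n A) (u : Fin n → Ultrafilter G) :
    ∃ g : G, ∀ i, {h : G | g * h ∈ A} ∈ u i := by
  obtain ⟨F, hF⟩ := hA
  choose x hx using fun i ↦ (u i).exists_forall_mem_imp_mem F fun f ↦ {h : G | f⁻¹ * h ∈ A}
  obtain ⟨f, hf, hfx⟩ := hF x
  exact ⟨f⁻¹, fun i ↦ hx i f hf (hfx i)⟩

/-- If every `n` ultrafilters lie in the closure of a common translate of `A`, then compactness
of `(βG)ⁿ` makes `A` an `n`-syndetic set. -/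
theorem IsNSyndetic.of_forall_exists_forall_mem {G : Type*} [Group G] {n : ℕ} {A : Set G}
    (hA : ∀ u : Fin n → Ultrafilter G, ∃ g : G, ∀ i, {h : G | g * h ∈ A} ∈ u i) :
    IsNSyndetic n A := by
  classical
  obtain ⟨t, ht⟩ := isCompact_univ.elim_finite_subcover
    (fun g : G ↦ {u : Fin n → Ultrafilter G | ∀ i, {h : G | g * h ∈ A} ∈ u i})
    (fun g ↦ by
      rw [Set.ofPred_forall]
      exact isOpen_iInter_of_finite fun i ↦
        IsOpen.preimage (f := fun u : Fin n → Ultrafilter G ↦ u i) (continuous_apply i)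
          (ultrafilter_isOpen_basic {h : G | g * h ∈ A}))
    (fun u _ ↦ Set.mem_iUnion.2 (hA u))
  refine ⟨t.image (·⁻¹), fun x ↦ ?_⟩
  obtain ⟨g, hg, hgx⟩ := Set.mem_iUnion₂.1 (ht (Set.mem_univ fun i ↦ (pure (x i) : Ultrafilter G)))
  refine ⟨g⁻¹, Finset.mem_image_of_mem _ hg, fun i ↦ ?_⟩
  simpa using Ultrafilter.mem_pure.1 (hgx i)

/-- `A` is `n`-syndetic iff for every finite set `S` of ultrafilters on `G` with `|S| ≤ n`
there is `g ∈ G` such that `g·𝒰` lies in the closure of `A` in `βG` for all `𝒰 ∈ S`,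
i.e. `{h : g·h ∈ A} ∈ 𝒰`. -/
theorem nSyndetic_iff_ultrafilters {G : Type*} [Group G] (n : ℕ) (hn : 1 ≤ n) (A : Set G) :
    IsNSyndetic n A ↔
      ∀ S : Finset (Ultrafilter G), S.card ≤ n →
        ∃ g : G, ∀ U ∈ S, {h : G | g * h ∈ A} ∈ U := by
  classical
  constructor
  · intro hA S hS
    obtain rfl | hne := S.eq_empty_or_nonempty
    · exact ⟨1, by simp⟩
    obtain ⟨u, hu⟩ := Finset.exists_fin_range_eq_of_card_le hne hS
    obtain ⟨g, hg⟩ := hA.exists_forall_mem u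
    refine ⟨g, fun U hU ↦ ?_⟩
    obtain ⟨i, rfl⟩ : U ∈ Set.range u := hu ▸ Finset.mem_coe.2 hU
    exact hg i
  · intro h
    refine .of_forall_exists_forall_mem fun u ↦ ?_
    obtain ⟨g, hg⟩ := h (Finset.univ.image u) (Finset.card_image_le.trans (by simp))
    exact ⟨g, fun i ↦ hg _ (Finset.mem_image_of_mem u (Finset.mem_univ i))⟩
end

section
/- Let G be a group. A subset A ⊆ G is completely syndetic if and only if there exists an ultrafilter x on G such that A ∈ x·y for every ultrafilter y on G (equivalently, the closure of A in the Stone–Čech compactification βG contains the right ideal x·βG of the semigroup βG). -/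
/-- If `A` is completely syndetic, then finitely many ultrafilters all contain a common
translate `g⁻¹A`. -/
theorem CompletelySyndetic.exists_forall_mem_ultrafilter {G : Type*} [Group G] {A : Set G}
    (hA : CompletelySyndetic A) {n : ℕ} (y : Fin n → Ultrafilter G) :
    ∃ g : G, ∀ i, {h : G | g * h ∈ A} ∈ y i := by
  rcases Nat.eq_zero_or_pos n with rfl | hn
  · exact ⟨1, fun i => i.elim0⟩
  obtain ⟨F, hF⟩ := hA n hn
  by_contra! hy
  have hne : ∀ i, ∃ x : G, ∀ f ∈ F, {h : G | f⁻¹ * h ∈ A} ∉ y i → f⁻¹ * x ∉ A := by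
    intro i
    have hev : ∀ᶠ x in (y i : Filter G),
        ∀ f ∈ F, {h : G | f⁻¹ * h ∈ A} ∉ y i → f⁻¹ * x ∉ A := by
      rw [Filter.eventually_all_finset]
      intro f _
      rw [Filter.eventually_imp_distrib_left]
      exact fun h => Ultrafilter.compl_mem_iff_notMem.2 h
    exact hev.exists
  choose x hx using hne
  obtain ⟨f, hf, hfA⟩ := hF x
  obtain ⟨i, hi⟩ := hy f⁻¹
  exact hx i f hf hi (hfA i)

/-- If every finite family of ultrafilters contains a common translate of `A`, then `A` is
`n`-syndetic. -/
theorem isNSyndetic_of_forall_ultrafilter {G : Type*} [Group G] {A : Set G} {n : ℕ}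
    (hA : ∀ y : Fin n → Ultrafilter G, ∃ g : G, ∀ i, {h : G | g * h ∈ A} ∈ y i) :
    IsNSyndetic n A := by
  by_contra hn
  have hx : ∀ F : Finset G, ∃ x : Fin n → G, ∀ f ∈ F, ∃ i, f⁻¹ * x i ∉ A := by
    simpa [IsNSyndetic] using hn
  choose x hx using hx
  classical
  let p : Ultrafilter (Finset G) := Ultrafilter.of Filter.atTop
  obtain ⟨g, hg⟩ := hA fun i => p.map fun F => x F i
  have hall : ∀ᶠ F in (p : Filter (Finset G)), ∀ i, g * x F i ∈ A :=
    Filter.eventually_all.2 hg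
  have hmem : ∀ᶠ F in (p : Filter (Finset G)), {g⁻¹} ≤ F :=
    Ultrafilter.of_le _ (Filter.eventually_ge_atTop _)
  obtain ⟨F, hF, hgF⟩ := (hall.and hmem).exists
  obtain ⟨i, hi⟩ := hx F g⁻¹ (hgF (Finset.mem_singleton_self _))
  exact hi (by simpa using hF i)

/-- `A ⊆ G` is completely syndetic iff there is an ultrafilter `x` on `G` such that
`A ∈ x·y` for every ultrafilter `y` on `G`, where `S ∈ x·y` means
`{g : {h : g·h ∈ S} ∈ y} ∈ x`; i.e. the closure of `A` in `βG` contains the right ideal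
`x·βG`. -/
theorem completelySyndetic_iff_rightIdeal {G : Type*} [Group G] (A : Set G) :
    CompletelySyndetic A ↔
      ∃ x : Ultrafilter G, ∀ y : Ultrafilter G,
        {g : G | {h : G | g * h ∈ A} ∈ y} ∈ x := by
  constructor
  · intro hA
    obtain ⟨x, hx⟩ := Ultrafilter.exists_ultrafilter_of_finite_inter_nonempty
      (Set.range fun y : Ultrafilter G => {g : G | {h : G | g * h ∈ A} ∈ y}) (by
        intro T hT
        choose y hy using fun t : T => hT t.2
        obtain ⟨g, hg⟩ := hA.exists_forall_mem_ultrafilter fun i => y (T.equivFin.symm i)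
        refine ⟨g, fun t ht => ?_⟩
        have hgt := hg (T.equivFin ⟨t, ht⟩)
        rw [Equiv.symm_apply_apply] at hgt
        have hyt : {g : G | {h : G | g * h ∈ A} ∈ y ⟨t, ht⟩} = t := hy ⟨t, ht⟩
        rw [← hyt]
        exact hgt)
    exact ⟨x, fun y => hx ⟨y, rfl⟩⟩
  · rintro ⟨x, hx⟩ n -
    refine isNSyndetic_of_forall_ultrafilter fun y => ?_
    have hall : ∀ᶠ g in (x : Filter G), ∀ i, {h : G | g * h ∈ A} ∈ y i :=
      Filter.eventually_all.2 fun i => hx (y i)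
    exact hall.exists
end

section
/- Let G be an amenable group and n ≥ 1. A subset A ⊆ G is n-syndetic if and only if every mean m on Gⁿ that is invariant under the diagonal left-translation action of G on Gⁿ satisfies m(χ_{Aⁿ}) > 0, where χ_{Aⁿ} is the indicator function of the set Aⁿ ⊆ Gⁿ. -/
/-- A real-valued function on `S` is bounded if its absolute value admits a uniform bound. -/
def IsBddFun {S : Type*} (f : S → ℝ) : Prop :=
  ∃ C : ℝ, ∀ s, |f s| ≤ C

/-- `m` is a mean on `S`: a (real linear, positive, unital) functional on the space of
bounded real-valued functions on `S`; we encode it as a functional on all functions whose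
behaviour is constrained only on bounded functions. -/
def IsMean {S : Type*} (m : (S → ℝ) → ℝ) : Prop :=
  (∀ f g : S → ℝ, IsBddFun f → IsBddFun g → m (f + g) = m f + m g) ∧
  (∀ (c : ℝ) (f : S → ℝ), IsBddFun f → m (c • f) = c * m f) ∧
  (∀ f : S → ℝ, IsBddFun f → (∀ s, 0 ≤ f s) → 0 ≤ m f) ∧
  m (fun _ => 1) = 1

open Filter Topology

theorem IsBddFun.tendsto_limUnder {S : Type*} {u : S → ℝ} (hu : IsBddFun u)
    (U : Ultrafilter S) : Tendsto u U (𝓝 (limUnder (U : Filter S) u)) := by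
  obtain ⟨C, hC⟩ := hu
  obtain ⟨a, -, ha⟩ := (isCompact_Icc (a := -C) (b := C)).ultrafilter_le_nhds (U.map u)
    (le_principal_iff.2 (Ultrafilter.mem_map.2 (univ_mem' fun s => abs_le.1 (hC s))))
  exact tendsto_nhds_limUnder ⟨a, ha⟩

theorem abs_limUnder_le {S : Type*} {u : S → ℝ} {C : ℝ} (hC : ∀ s, |u s| ≤ C)
    (U : Ultrafilter S) : |limUnder (U : Filter S) u| ≤ C :=
  le_of_tendsto (IsBddFun.tendsto_limUnder ⟨C, hC⟩ U).abs (Eventually.of_forall hC)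

theorem IsBddFun.comp {S T : Type*} {f : S → ℝ} (hf : IsBddFun f) (φ : T → S) :
    IsBddFun fun t => f (φ t) :=
  hf.imp fun _ h t => h (φ t)

theorem IsBddFun.add {S : Type*} {f g : S → ℝ} (hf : IsBddFun f) (hg : IsBddFun g) :
    IsBddFun (f + g) := by
  obtain ⟨C, hC⟩ := hf
  obtain ⟨D, hD⟩ := hg
  exact ⟨C + D, fun s => (abs_add_le _ _).trans (add_le_add (hC s) (hD s))⟩

theorem IsBddFun.const_smul {S : Type*} {f : S → ℝ} (c : ℝ) (hf : IsBddFun f) :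
    IsBddFun (c • f) := by
  obtain ⟨C, hC⟩ := hf
  refine ⟨|c| * C, fun s => ?_⟩
  rw [Pi.smul_apply, smul_eq_mul, abs_mul]
  exact mul_le_mul_of_nonneg_left (hC s) (abs_nonneg c)

theorem isBddFun_const (S : Type*) (c : ℝ) : IsBddFun fun _ : S => c :=
  ⟨|c|, fun _ => le_rfl⟩

theorem isBddFun_indicator_one {S : Type*} (B : Set S) :
    IsBddFun (B.indicator fun _ => (1 : ℝ)) :=
  ⟨1, fun s => by by_cases h : s ∈ B <;> simp [h]⟩

theorem isBddFun_sum {S ι : Type*} (F : Finset ι) {f : ι → S → ℝ}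
    (hf : ∀ i, IsBddFun (f i)) : IsBddFun (∑ i ∈ F, f i) :=
  Finset.sum_induction f IsBddFun (fun _ _ => IsBddFun.add) (isBddFun_const S 0)
    fun i _ => hf i

theorem IsMean.map_sum {S ι : Type*} {m : (S → ℝ) → ℝ} (hm : IsMean m) (F : Finset ι)
    {f : ι → S → ℝ} (hf : ∀ i, IsBddFun (f i)) : m (∑ i ∈ F, f i) = ∑ i ∈ F, m (f i) := by
  classical
  induction F using Finset.induction_on with
  | empty => simpa using hm.2.1 0 (fun _ => 0) (isBddFun_const S 0)
  | insert a F ha ih =>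
    rw [Finset.sum_insert ha, Finset.sum_insert ha, hm.1 _ _ (hf a) (isBddFun_sum F hf), ih]

theorem IsMean.one_le {S : Type*} {m : (S → ℝ) → ℝ} (hm : IsMean m) {f : S → ℝ}
    (hf : IsBddFun f) (h : ∀ s, 1 ≤ f s) : 1 ≤ m f := by
  have hb := isBddFun_const S 1
  have h0 := hm.2.2.1 (f + (-1 : ℝ) • fun _ => 1) (hf.add (hb.const_smul _)) fun s => by
    simpa using h s
  rw [hm.1 _ _ hf (hb.const_smul _), hm.2.1 _ _ hb, hm.2.2.2] at h0
  linarith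

/-- Averaging, with a mean `μ` on `G`, the ultrafilter limits of `f` along the translates of
a family of points. -/
noncomputable def orbitLimitMean {G T X : Type*} [SMul G X] (μ : (G → ℝ) → ℝ)
    (U : Ultrafilter T) (x : T → X) (f : X → ℝ) : ℝ :=
  μ fun h => limUnder (U : Filter T) fun t => f (h • x t)

theorem IsBddFun.limUnder_smul {G T X : Type*} [SMul G X] {f : X → ℝ} (hf : IsBddFun f)
    (U : Ultrafilter T) (x : T → X) :
    IsBddFun fun h : G => limUnder (U : Filter T) fun t => f (h • x t) :=
  hf.imp fun _ hC _ => abs_limUnder_le (fun _ => hC _) U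

theorem isMean_orbitLimitMean {G T X : Type*} [SMul G X] {μ : (G → ℝ) → ℝ} (hμ : IsMean μ)
    (U : Ultrafilter T) (x : T → X) : IsMean (orbitLimitMean μ U x) := by
  refine ⟨fun f g hf hg => ?_, fun c f hf => ?_, fun f hf h0 => ?_, ?_⟩
  · refine Eq.trans (congrArg μ (funext fun h => ?_))
      (hμ.1 _ _ (hf.limUnder_smul U x) (hg.limUnder_smul U x))
    exact (((hf.comp _).tendsto_limUnder U).add ((hg.comp _).tendsto_limUnder U)).limUnder_eq
  · refine Eq.trans (congrArg μ (funext fun h => ?_)) (hμ.2.1 c _ (hf.limUnder_smul U x))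
    exact (((hf.comp _).tendsto_limUnder U).const_smul c).limUnder_eq
  · exact hμ.2.2.1 _ (hf.limUnder_smul U x) fun h =>
      ge_of_tendsto ((hf.comp _).tendsto_limUnder U) (Eventually.of_forall fun _ => h0 _)
  · exact Eq.trans (congrArg μ (funext fun h => tendsto_const_nhds.limUnder_eq)) hμ.2.2.2

theorem orbitLimitMean_smul {G T X : Type*} [Group G] [MulAction G X] {μ : (G → ℝ) → ℝ}
    (hμ : ∀ (g : G) (f : G → ℝ), IsBddFun f → μ (fun h => f (g * h)) = μ f)
    (U : Ultrafilter T) (x : T → X) (g : G) {f : X → ℝ} (hf : IsBddFun f) :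
    orbitLimitMean μ U x (fun y => f (g • y)) = orbitLimitMean μ U x f := by
  unfold orbitLimitMean
  simpa only [mul_smul] using hμ g _ (hf.limUnder_smul U x)

theorem IsNSyndetic.mean_indicator_pos {G : Type*} [Group G] {n : ℕ} {A : Set G}
    (hA : IsNSyndetic n A) {m : ((Fin n → G) → ℝ) → ℝ} (hm : IsMean m)
    (hinv : ∀ (g : G) (f : (Fin n → G) → ℝ), IsBddFun f →
      m (fun x => f (fun i => g * x i)) = m f) :
    0 < m (Set.indicator {x : Fin n → G | ∀ i, x i ∈ A} fun _ => (1 : ℝ)) := by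
  obtain ⟨F, hF⟩ := hA
  set χ := Set.indicator {x : Fin n → G | ∀ i, x i ∈ A} fun _ => (1 : ℝ)
  have hχb : IsBddFun χ := isBddFun_indicator_one _
  have hχ0 : ∀ x, 0 ≤ χ x := Set.indicator_nonneg fun _ _ => zero_le_one
  let t : G → (Fin n → G) → ℝ := fun g x => χ fun i => g⁻¹ * x i
  have htb : ∀ g, IsBddFun (t g) := fun g => hχb.comp _
  have h1 : 1 ≤ m (∑ g ∈ F, t g) := by
    refine hm.one_le (isBddFun_sum F htb) fun x => ?_
    obtain ⟨g, hg, hgA⟩ := hF x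
    rw [Finset.sum_apply]
    have hmem : (fun i => g⁻¹ * x i) ∈ {x : Fin n → G | ∀ i, x i ∈ A} := hgA
    calc (1 : ℝ) = t g x := (Set.indicator_of_mem hmem fun _ => (1 : ℝ)).symm
      _ ≤ ∑ g ∈ F, t g x := Finset.single_le_sum (f := fun g => t g x) (fun _ _ => hχ0 _) hg
  rw [hm.map_sum F htb, Finset.sum_congr rfl fun g _ => hinv g⁻¹ χ hχb, Finset.sum_const,
    nsmul_eq_mul] at h1
  exact pos_of_mul_pos_right (zero_lt_one.trans_le h1) (Nat.cast_nonneg _)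

theorem exists_invariant_mean_indicator_eq_zero {G : Type*} [Group G] {μ : (G → ℝ) → ℝ}
    (hμ : IsMean μ) (hinv : ∀ (g : G) (f : G → ℝ), IsBddFun f → μ (fun h => f (g * h)) = μ f)
    {n : ℕ} {A : Set G} (hA : ¬ IsNSyndetic n A) :
    ∃ m : ((Fin n → G) → ℝ) → ℝ, IsMean m ∧
      (∀ (g : G) (f : (Fin n → G) → ℝ), IsBddFun f →
        m (fun x => f (fun i => g * x i)) = m f) ∧
      m (Set.indicator {x : Fin n → G | ∀ i, x i ∈ A} fun _ => (1 : ℝ)) = 0 := by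
  classical
  unfold IsNSyndetic at hA
  push Not at hA
  choose x hx using hA
  let U : Ultrafilter (Finset G) := Ultrafilter.of atTop
  refine ⟨orbitLimitMean μ U x, isMean_orbitLimitMean hμ U x,
    fun g f hf => orbitLimitMean_smul hinv U x g hf, ?_⟩
  have h0 : μ (fun _ => 0) = 0 := by
    have h := hμ.2.1 0 (fun _ => 0) (isBddFun_const G 0)
    rw [zero_mul, zero_smul] at h
    exact h
  refine Eq.trans (congrArg μ (funext fun h => ?_)) h0
  refine Tendsto.limUnder_eq (tendsto_const_nhds.congr' ?_)
  have hev : ∀ᶠ F : Finset G in (U : Filter (Finset G)), {h⁻¹} ≤ F :=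
    Ultrafilter.of_le atTop (eventually_ge_atTop {h⁻¹})
  filter_upwards [hev] with F hF
  obtain ⟨i, hi⟩ := hx F h⁻¹ (Finset.singleton_subset_iff.1 hF)
  rw [inv_inv] at hi
  have hmem : h • x F ∉ {x : Fin n → G | ∀ i, x i ∈ A} := fun hmem => hi (hmem i)
  exact (Set.indicator_of_notMem hmem _).symm

/-- For an amenable group `G` (there is a left-invariant mean on `G`), a subset `A ⊆ G` is
`n`-syndetic iff every mean `m` on `Gⁿ` invariant under the diagonal left-translation
action of `G` satisfies `m(χ_{Aⁿ}) > 0`. -/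
theorem nSyndetic_iff_means {G : Type*} [Group G]
    (hAmen : ∃ m : (G → ℝ) → ℝ, IsMean m ∧
      ∀ (g : G) (f : G → ℝ), IsBddFun f → m (fun h => f (g * h)) = m f)
    (n : ℕ) (hn : 1 ≤ n) (A : Set G) :
    IsNSyndetic n A ↔
      ∀ m : ((Fin n → G) → ℝ) → ℝ, IsMean m →
        (∀ (g : G) (f : (Fin n → G) → ℝ), IsBddFun f →
          m (fun x => f (fun i => g * x i)) = m f) →
        0 < m (Set.indicator {x : Fin n → G | ∀ i, x i ∈ A} fun _ => (1 : ℝ)) := by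
  obtain ⟨μ, hμ, hinv⟩ := hAmen
  refine ⟨fun hA m hm hm' => hA.mean_indicator_pos hm hm', fun H => ?_⟩
  by_contra hA
  obtain ⟨m, hm, hm', h0⟩ := exists_invariant_mean_indicator_eq_zero hμ hinv hA
  exact (H m hm hm').ne' h0
end

section
/- Let G be a countable group, let A ⊆ G, let X be the subshift generated by A, and let n ≥ 1. Then: (i) A is n-syndetic if and only if for all B₁,…,Bₙ ∈ X one has B₁ ∩ ⋯ ∩ Bₙ ≠ ∅; and (ii) the complement Aᶜ is n-syndetic if and only if for all B₁,…,Bₙ ∈ X one has B₁ ∪ ⋯ ∪ Bₙ ≠ G. -/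
/-- The indicator function of a subset `B ⊆ G`, viewed as a point of the Bernoulli shift
`2^G = {0,1}^G` (with the product topology on `G → Bool`). -/
noncomputable def setIndicator {G : Type*} (B : Set G) : G → Bool :=
  fun g => @decide (g ∈ B) (Classical.propDecidable _)

/-- The subshift generated by `A ⊆ G`: the closure in `2^G` (with the product topology)
of the orbit `{A·g : g ∈ G}` of `A` under right translation. -/
noncomputable def subshiftGeneratedBy {G : Type*} [Group G] (A : Set G) : Set (G → Bool) :=
  closure {x : G → Bool | ∃ g : G, x = setIndicator ((fun a => a * g) '' A)}

theorem setIndicator_eq_true_iff {G : Type*} {B : Set G} {g : G} :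
    setIndicator B g = true ↔ g ∈ B := by
  simp [setIndicator]

theorem setIndicator_eq_false_iff {G : Type*} {B : Set G} {g : G} :
    setIndicator B g = false ↔ g ∉ B := by
  simp [setIndicator]

theorem setIndicator_image_mul_right {G : Type*} [Group G] (A : Set G) (g h : G) :
    setIndicator ((fun a => a * g) '' A) h = setIndicator A (h * g⁻¹) := by
  rw [Bool.eq_iff_iff, setIndicator_eq_true_iff, setIndicator_eq_true_iff]
  simp

/-- Every point of the subshift agrees with some translate of `A` on any given finite set. -/
theorem exists_translate_eq_on_finset {G : Type*} [Group G] {A : Set G} {x : G → Bool}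
    (hx : x ∈ subshiftGeneratedBy A) (F : Finset G) :
    ∃ g : G, ∀ h ∈ F, setIndicator A (h * g⁻¹) = x h := by
  have hopen : IsOpen (Set.pi (F : Set G) fun h => ({x h} : Set Bool)) :=
    isOpen_set_pi F.finite_toSet fun _ _ => isOpen_discrete _
  obtain ⟨_, hy, g, rfl⟩ := mem_closure_iff.1 hx _ hopen fun _ _ => rfl
  exact ⟨g, fun h hh => (setIndicator_image_mul_right A g h).symm.trans (hy h hh)⟩

/-- The level set of the indicator function of `A` at `b` is `n`-syndetic if and only if any `n`
points of the subshift generated by `A` take the value `b` simultaneously. -/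
theorem isNSyndetic_level_set_iff {G : Type*} [Group G] (A : Set G) (n : ℕ) (b : Bool) :
    IsNSyndetic n {a | setIndicator A a = b} ↔
      ∀ B : Fin n → (G → Bool), (∀ i, B i ∈ subshiftGeneratedBy A) →
        ∃ h : G, ∀ i, B i h = b := by
  classical
  constructor
  · rintro ⟨F, hF⟩ B hB
    choose g hg using fun i => exists_translate_eq_on_finset (hB i) (F.image (·⁻¹))
    obtain ⟨f, hf, hfb⟩ := hF fun i => (g i)⁻¹
    exact ⟨f⁻¹, fun i =>
      (hg i f⁻¹ (Finset.mem_image_of_mem _ hf)).symm.trans (hfb i)⟩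
  · intro H
    have hK : IsCompact (Set.pi Set.univ fun _ : Fin n => subshiftGeneratedBy A) :=
      isCompact_univ_pi fun _ => isClosed_closure.isCompact
    obtain ⟨t, ht⟩ := hK.elim_finite_subcover
      (fun h : G => {B : Fin n → (G → Bool) | ∀ i, B i h = b})
      (fun h => by
        simp only [Set.ofPred_forall]
        refine isOpen_iInter_of_finite fun i => ?_
        have hc : Continuous fun B : Fin n → (G → Bool) => B i h := by fun_prop
        exact (isOpen_discrete ({b} : Set Bool)).preimage hc)
      (fun B hB => Set.mem_iUnion.2 (H B fun i => hB i (Set.mem_univ i)))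
    refine ⟨t.image (·⁻¹), fun x => ?_⟩
    have hx := @ht (fun i => setIndicator ((fun a => a * (x i)⁻¹) '' A))
      fun i _ => subset_closure ⟨(x i)⁻¹, rfl⟩
    obtain ⟨h, hht, hh⟩ := Set.mem_iUnion₂.1 hx
    refine ⟨h⁻¹, Finset.mem_image_of_mem _ hht, fun i => ?_⟩
    have hi := (setIndicator_image_mul_right A (x i)⁻¹ h).symm.trans (hh i)
    simpa using hi

/-- For a countable group `G`, `A ⊆ G`, `X` the subshift generated by `A`, and `n ≥ 1`:
(i) `A` is `n`-syndetic iff any `B₁, …, Bₙ ∈ X` satisfy `B₁ ∩ ⋯ ∩ Bₙ ≠ ∅`;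
(ii) `Aᶜ` is `n`-syndetic iff any `B₁, …, Bₙ ∈ X` satisfy `B₁ ∪ ⋯ ∪ Bₙ ≠ G`. -/
theorem subshift_characterization {G : Type*} [Group G] [Countable G] (A : Set G)
    (n : ℕ) (hn : 1 ≤ n) :
    (IsNSyndetic n A ↔
      ∀ B : Fin n → (G → Bool), (∀ i, B i ∈ subshiftGeneratedBy A) →
        ∃ h : G, ∀ i, B i h = true) ∧
    (IsNSyndetic n Aᶜ ↔
      ∀ B : Fin n → (G → Bool), (∀ i, B i ∈ subshiftGeneratedBy A) →
        ∃ h : G, ∀ i, B i h = false) := by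
  constructor
  · simpa only [setIndicator_eq_true_iff, Set.ofPred_mem_eq] using
      isNSyndetic_level_set_iff A n true
  · simpa only [setIndicator_eq_false_iff, ← Set.compl_def] using isNSyndetic_level_set_iff A n false
end

section
/- Let G be a group. If a subset A ⊆ G is strongly completely syndetic, then A is completely syndetic. -/
open Classical in
/-- `A ⊆ G` is strongly completely syndetic if for every `ε > 0` there is a finite set
`F ⊆ G` such that for every finite multiset `K` of elements of `G` there is `f ∈ F` with
`|f·K ∩ A| ≥ (1 - ε)·|K|`, counting with multiplicity. -/
def StronglyCompletelySyndetic {G : Type*} [Group G] (A : Set G) : Prop :=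
  ∀ ε : ℝ, 0 < ε → ∃ F : Finset G, ∀ K : Multiset G, ∃ f ∈ F,
    (1 - ε) * (Multiset.card K : ℝ) ≤
      (Multiset.card ((K.map (fun x => f * x)).filter (fun x => x ∈ A)) : ℝ)

theorem stronglyCompletelySyndetic_completelySyndetic {G : Type*} [Group G] (A : Set G)
    (h : StronglyCompletelySyndetic A) : CompletelySyndetic A := by
  classical
  intro n _
  obtain ⟨F, hF⟩ := h (1 / ((n : ℝ) + 1)) (by positivity)
  refine ⟨F.image (·⁻¹), fun x => ?_⟩
  obtain ⟨f, hf, hle⟩ := hF ((Finset.univ : Finset (Fin n)).val.map x)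
  refine ⟨f⁻¹, Finset.mem_image_of_mem _ hf, fun i => ?_⟩
  set M := ((Finset.univ : Finset (Fin n)).val.map x).map (fun y => f * y) with hM
  have hcard : Multiset.card M = n := by simp [hM]
  have hlt : (n : ℝ) - 1 < (1 - 1 / ((n : ℝ) + 1)) * n := by
    have hn : (n : ℝ) + 1 ≠ 0 := by positivity
    have hsub : (1 - 1 / ((n : ℝ) + 1)) * n - (n - 1) = 1 / ((n : ℝ) + 1) := by
      field_simp
      ring
    have hpos : 0 < 1 / ((n : ℝ) + 1) := by positivity
    linarith
  simp only [Multiset.card_map, Finset.card_val, Finset.card_univ, Fintype.card_fin] at hle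
  have hfilter : Multiset.filter (fun y => y ∈ A) M = M := by
    refine Multiset.eq_of_le_of_card_le (Multiset.filter_le _ M) ?_
    rw [hcard]
    have hreal := hlt.trans_le hle
    rw [sub_lt_iff_lt_add] at hreal
    have hnat : n < Multiset.card (Multiset.filter (fun y => y ∈ A) M) + 1 := by
      exact_mod_cast hreal
    exact Nat.lt_succ_iff.mp hnat
  rw [inv_inv]
  exact Multiset.filter_eq_self.mp hfilter _ (by simp [hM])
end

section
/- Let G be a group acting by homeomorphisms on a nonempty compact Hausdorff space X, and assume the G-flow X is minimal and proximal. Then for every nonempty open subset U ⊆ X and every point x ∈ X, the return set U_x = {g ∈ G : g·x ∈ U} is a completely syndetic subset of G. -/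
/-- In a minimal proximal flow, any two points can be moved simultaneously into any given
nonempty open set. -/
theorem exists_smul_mem_pair {G : Type*} [Group G] {X : Type*}
    [TopologicalSpace X] [MulAction G X]
    (hcont : ∀ g : G, Continuous fun x : X => g • x)
    (hmin : ∀ x : X, Dense (Set.range fun g : G => g • x))
    (hprox : ∀ x y : X, ∃ z : X,
      (z, z) ∈ closure {p : X × X | ∃ g : G, p = (g • x, g • y)})
    {U : Set X} (hU : IsOpen U) (hUne : U.Nonempty) (x y : X) :
    ∃ g : G, g • x ∈ U ∧ g • y ∈ U := by
  obtain ⟨z, hz⟩ := hprox x y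
  obtain ⟨_, hk, k, rfl⟩ := (hmin z).inter_open_nonempty U hU hUne
  have hV : IsOpen ((fun x : X => k • x) ⁻¹' U) := hU.preimage (hcont k)
  obtain ⟨_, ⟨h₁, h₂⟩, g, rfl⟩ := mem_closure_iff.mp hz _ (hV.prod hV) ⟨hk, hk⟩
  exact ⟨k * g, by simpa [mul_smul] using h₁, by simpa [mul_smul] using h₂⟩

/-- In a compact minimal proximal flow, any finite set of points can be moved simultaneously
into any given nonempty open set. -/
theorem exists_smul_mem_of_finite {G : Type*} [Group G] {X : Type*}
    [TopologicalSpace X] [CompactSpace X] [MulAction G X]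
    (hcont : ∀ g : G, Continuous fun x : X => g • x)
    (hmin : ∀ x : X, Dense (Set.range fun g : G => g • x))
    (hprox : ∀ x y : X, ∃ z : X,
      (z, z) ∈ closure {p : X × X | ∃ g : G, p = (g • x, g • y)})
    {s : Set X} (hs : s.Finite) {U : Set X} (hU : IsOpen U) (hUne : U.Nonempty) :
    ∃ g : G, ∀ y ∈ s, g • y ∈ U := by
  induction s, hs using Set.Finite.induction_on generalizing U with
  | empty => exact ⟨1, by simp⟩
  | @insert a s _ _ ih =>
    obtain ⟨z, -⟩ := id hUne
    choose g hgw hgz using fun w => exists_smul_mem_pair hcont hmin hprox hU hUne w z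
    have hopen : ∀ w, IsOpen ((fun x : X => g w • x) ⁻¹' U) := fun w => hU.preimage (hcont _)
    obtain ⟨t, ht⟩ := isCompact_univ.elim_finite_subcover
      (fun w => (fun x : X => g w • x) ⁻¹' U) hopen
      (fun w _ => Set.mem_iUnion.mpr ⟨w, hgw w⟩)
    obtain ⟨h, hh⟩ := ih (U := ⋂ w ∈ t, (fun x : X => g w • x) ⁻¹' U)
      (isOpen_biInter_finset fun w _ => hopen w) ⟨z, Set.mem_iInter₂.mpr fun w _ => hgz w⟩
    obtain ⟨w, hwt, hw⟩ := Set.mem_iUnion₂.mp (ht (Set.mem_univ (h • a)))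
    refine ⟨g w * h, ?_⟩
    rintro y (rfl | hy)
    · simpa [mul_smul] using hw
    · simpa [mul_smul] using Set.mem_iInter₂.mp (hh y hy) w hwt

/-- If `X` is a minimal proximal `G`-flow (a nonempty compact Hausdorff space with a
`G`-action by homeomorphisms that is minimal and proximal), then for every nonempty open
`U ⊆ X` and every `x ∈ X` the return set `U_x = {g : g • x ∈ U}` is completely syndetic. -/
theorem returnSet_completelySyndetic {G : Type*} [Group G] {X : Type*}
    [TopologicalSpace X] [CompactSpace X] [T2Space X] [Nonempty X] [MulAction G X]
    (hcont : ∀ g : G, Continuous fun x : X => g • x)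
    (hmin : ∀ x : X, Dense (Set.range fun g : G => g • x))
    (hprox : ∀ x y : X, ∃ z : X,
      (z, z) ∈ closure {p : X × X | ∃ g : G, p = (g • x, g • y)})
    (U : Set X) (hU : IsOpen U) (hUne : U.Nonempty) (x : X) :
    CompletelySyndetic {g : G | g • x ∈ U} := by
  classical
  intro n _
  obtain ⟨t, ht⟩ := (isCompact_univ (X := Fin n → X)).elim_finite_subcover
    (fun g : G => ⋂ i, (fun y : Fin n → X => g • y i) ⁻¹' U)
    (fun g => isOpen_iInter_of_finite fun i =>
      hU.preimage ((hcont g).comp (continuous_apply i)))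
    (fun y _ => by
      obtain ⟨g, hg⟩ :=
        exists_smul_mem_of_finite hcont hmin hprox (Set.finite_range y) hU hUne
      exact Set.mem_iUnion.mpr ⟨g, Set.mem_iInter.mpr fun i => hg _ ⟨i, rfl⟩⟩)
  refine ⟨t.image (·⁻¹), fun a => ?_⟩
  obtain ⟨g, hgt, hg⟩ := Set.mem_iUnion₂.mp (ht (Set.mem_univ fun i => a i • x))
  refine ⟨g⁻¹, Finset.mem_image_of_mem _ hgt, fun i => ?_⟩
  simpa [mul_smul] using Set.mem_iInter.mp hg i
end

section
/- Let G be a group acting by homeomorphisms on a nonempty compact Hausdorff space X, and assume the G-flow X is minimal and strongly proximal. Then for every nonempty open subset U ⊆ X and every point x ∈ X, the return set U_x = {g ∈ G : g·x ∈ U} is a strongly completely syndetic subset of G. -/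
open MeasureTheory

open Filter Topology

section EmpiricalMeasure

variable {X : Type*} [MeasurableSpace X] [MeasurableSingletonClass X]

lemma integrable_sum_map_dirac (S : Multiset X) (f : X → ℝ) :
    Integrable f (S.map Measure.dirac).sum := by
  induction S using Multiset.induction_on with
  | empty => simp
  | cons a S ih =>
    rw [Multiset.map_cons, Multiset.sum_cons]
    exact (integrable_dirac (by simp)).add_measure ih

lemma integral_sum_map_dirac (S : Multiset X) (f : X → ℝ) :
    ∫ y, f y ∂(S.map Measure.dirac).sum = (S.map f).sum := by
  induction S using Multiset.induction_on with
  | empty => simp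
  | cons a S ih =>
    rw [Multiset.map_cons, Multiset.sum_cons, Multiset.map_cons, Multiset.sum_cons,
      integral_add_measure (integrable_dirac (by simp)) (integrable_sum_map_dirac S f),
      integral_dirac, ih]

/-- The empirical measure of a nonempty finite multiset of points. -/
lemma exists_probabilityMeasure_integral_eq_average {S : Multiset X} (hS : S ≠ 0) :
    ∃ μ : ProbabilityMeasure X, ∀ f : X → ℝ,
      ∫ y, f y ∂(μ : Measure X) = (Multiset.card S : ℝ)⁻¹ * (S.map f).sum := by
  have hmass (T : Multiset X) :
      (T.map Measure.dirac).sum Set.univ = (Multiset.card T : ENNReal) := by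
    induction T using Multiset.induction_on with
    | empty => simp
    | cons a T ih => simp [ih, add_comm]
  refine ⟨⟨(Multiset.card S : ENNReal)⁻¹ • (S.map Measure.dirac).sum, ⟨?_⟩⟩, fun f => ?_⟩
  · rw [Measure.smul_apply, hmass, smul_eq_mul]
    exact ENNReal.inv_mul_cancel (by simpa using hS) (by simp)
  · rw [ProbabilityMeasure.coe_mk, integral_smul_measure, integral_sum_map_dirac]
    simp

end EmpiricalMeasure

open Classical in
lemma Multiset.sum_map_le_card_filter {α : Type*} (S : Multiset α) {p : α → Prop} {f : α → ℝ}
    (hf : ∀ a, f a ≤ 1) (hfp : ∀ a, ¬ p a → f a ≤ 0) :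
    (S.map f).sum ≤ (Multiset.card (S.filter p) : ℝ) := by
  induction S using Multiset.induction_on with
  | empty => simp
  | cons a S ih =>
    by_cases ha : p a
    · simp [ha]
      linarith [hf a]
    · simp [ha]
      linarith [hfp a ha]

/-- In a minimal strongly proximal flow, every probability measure can be pushed by a group
element so as to be almost concentrated on a given nonempty open set. -/
lemma exists_one_sub_lt_integral_smul {G : Type*} [Group G] {X : Type*}
    [TopologicalSpace X] [CompactSpace X] [T2Space X]
    [MeasurableSpace X] [BorelSpace X] [MulAction G X]
    (hcont : ∀ g : G, Continuous fun x : X => g • x)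
    (hmin : ∀ x : X, Dense (Set.range fun g : G => g • x))
    (hsprox : ∀ μ : ProbabilityMeasure X, ∃ z : X,
      (⟨Measure.dirac z, inferInstance⟩ : ProbabilityMeasure X) ∈
        closure {ν : ProbabilityMeasure X | ∃ g : G,
          ν = μ.map ((hcont g).measurable.aemeasurable)})
    {U : Set X} (hU : IsOpen U) (hUne : U.Nonempty) (μ : ProbabilityMeasure X)
    {ε : ℝ} (hε : 0 < ε) :
    ∃ φ : C(X, ℝ), (∀ y, φ y ≤ 1) ∧ (∀ y, y ∉ U → φ y ≤ 0) ∧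
      ∃ g : G, 1 - ε < ∫ y, φ (g • y) ∂(μ : Measure X) := by
  obtain ⟨z, hz⟩ := hsprox μ
  obtain ⟨_, hhU, h, rfl⟩ := (hmin z).inter_open_nonempty U hU hUne
  obtain ⟨φ, hφ0, hφ1, hφ⟩ := exists_continuous_zero_one_of_isClosed hU.isClosed_compl
    (isClosed_singleton (x := h • z)) (by simpa using hhU)
  refine ⟨φ, fun y => (hφ y).2, fun y hy => (hφ0 hy).le, ?_⟩
  let ψ : C(X, ℝ) := φ.comp ⟨_, hcont h⟩
  have hopen : IsOpen {ν : ProbabilityMeasure X | 1 - ε < ∫ y, ψ y ∂(ν : Measure X)} :=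
    isOpen_lt continuous_const (ProbabilityMeasure.continuous_integral_continuousMap ψ)
  obtain ⟨ν, hν, g, rfl⟩ := (mem_closure_iff (X := ProbabilityMeasure X)).1 hz _ hopen (by
    have hφz : φ (h • z) = 1 := hφ1 rfl
    change 1 - ε < ∫ y, ψ y ∂Measure.dirac z
    simp [ψ, hφz, hε])
  refine ⟨h * g, ?_⟩
  change 1 - ε < ∫ y, ψ y ∂(μ.map (hcont g).measurable.aemeasurable : Measure X) at hν
  rw [ProbabilityMeasure.toMeasure_map, integral_map (hcont g).measurable.aemeasurable
    ψ.continuous.aestronglyMeasurable] at hν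
  simpa [ψ, mul_smul] using hν

/-- If `X` is a minimal strongly proximal `G`-flow (a nonempty compact Hausdorff space with
a `G`-action by homeomorphisms that is minimal, and such that the closure of the `G`-orbit
of every Borel probability measure, in the topology of weak convergence, contains a Dirac
measure), then for every nonempty open `U ⊆ X` and every `x ∈ X` the return set
`U_x = {g : g • x ∈ U}` is strongly completely syndetic. -/
theorem returnSet_stronglyCompletelySyndetic {G : Type*} [Group G] {X : Type*}
    [TopologicalSpace X] [CompactSpace X] [T2Space X] [Nonempty X]
    [MeasurableSpace X] [BorelSpace X] [MulAction G X]
    (hcont : ∀ g : G, Continuous fun x : X => g • x)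
    (hmin : ∀ x : X, Dense (Set.range fun g : G => g • x))
    (hsprox : ∀ μ : ProbabilityMeasure X, ∃ z : X,
      (⟨Measure.dirac z, inferInstance⟩ : ProbabilityMeasure X) ∈
        closure {ν : ProbabilityMeasure X | ∃ g : G,
          ν = μ.map ((hcont g).measurable.aemeasurable)})
    (U : Set X) (hU : IsOpen U) (hUne : U.Nonempty) (x : X) :
    StronglyCompletelySyndetic {g : G | g • x ∈ U} := by
  classical
  intro ε hε
  by_contra! hcon
  choose K hK using hcon
  have hK0 (F : Finset G) : (K (insert 1 F)).map (fun k => k • x) ≠ 0 := by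
    intro h0
    have h := hK (insert 1 F) 1 (by simp)
    rw [Multiset.map_eq_zero] at h0
    simp [h0] at h
  choose μ hμ using fun F => exists_probabilityMeasure_integral_eq_average (hK0 F)
  obtain ⟨m, -, hm⟩ := isCompact_univ.ultrafilter_le_nhds
    ((Ultrafilter.of (atTop : Filter (Finset G))).map μ) (by simp)
  obtain ⟨φ, hφ1, hφU, g, hg⟩ := exists_one_sub_lt_integral_smul hcont hmin hsprox hU hUne m hε
  have hlim : Tendsto (fun F => ∫ y, φ (g • y) ∂(μ F : Measure X))
      (Ultrafilter.of (atTop : Filter (Finset G))) (𝓝 (∫ y, φ (g • y) ∂(m : Measure X))) :=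
    ((ProbabilityMeasure.continuous_integral_continuousMap
      (φ.comp ⟨_, hcont g⟩)).tendsto m).comp hm
  refine hg.not_ge (le_of_tendsto hlim ?_)
  filter_upwards [Ultrafilter.of_le _ (mem_atTop {g})] with F hF
  have hgF : g ∈ insert 1 F := Finset.mem_insert_of_mem (hF (Finset.mem_singleton_self g))
  have hcard : (0 : ℝ) < Multiset.card ((K (insert 1 F)).map (fun k => k • x)) :=
    Nat.cast_pos.2 (Multiset.card_pos.2 (hK0 F))
  rw [hμ F, inv_mul_le_iff₀ hcard, Multiset.card_map, mul_comm, Multiset.map_map]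
  have hsum := Multiset.sum_map_le_card_filter ((K (insert 1 F)).map (fun k => g * k))
    (p := fun k => k ∈ {g : G | g • x ∈ U}) (f := fun k => φ (k • x))
    (fun k => hφ1 _) (fun k hk => hφU _ hk)
  rw [Multiset.map_map] at hsum
  simp only [Function.comp_def, mul_smul] at hsum ⊢
  convert hsum.trans (hK _ g hgF).le using 1
end

section
/- Let G be a group. There exists a minimal proximal G-flow having at least two points (i.e., G is not strongly amenable) if and only if G contains a proper subset A ⊊ G that is symmetrically completely syndetic. -/
/-- `A ⊆ G` is symmetrically completely syndetic if it is completely syndetic and for all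
finite `F₁, F₂ ⊆ G` the set `(⋂_{f ∈ F₁} f·A) ∩ (⋂_{f ∈ F₂} f·Aᶜ)` is either completely
syndetic or empty (here `f·A = {x : f⁻¹ x ∈ A}`). -/
def SymmetricallyCompletelySyndetic {G : Type*} [Group G] (A : Set G) : Prop :=
  CompletelySyndetic A ∧ ∀ F₁ F₂ : Finset G,
    CompletelySyndetic
      ((⋂ f ∈ F₁, {x : G | f⁻¹ * x ∈ A}) ∩ (⋂ f ∈ F₂, {x : G | f⁻¹ * x ∈ Aᶜ})) ∨
    ((⋂ f ∈ F₁, {x : G | f⁻¹ * x ∈ A}) ∩ (⋂ f ∈ F₂, {x : G | f⁻¹ * x ∈ Aᶜ})) = ∅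

/-- A minimal proximal `G`-flow: a nonempty compact Hausdorff space with a `G`-action by
homeomorphisms whose orbits are all dense, and such that for any two points `x, y` there
is `z` with `(z, z)` in the closure of `{(g • x, g • y) : g ∈ G}`. -/
structure MinimalProximalFlow (G : Type u) [Group G] where
  X : Type u
  [topX : TopologicalSpace X]
  [mulAction : MulAction G X]
  compact : CompactSpace X
  t2 : T2Space X
  nonempty : Nonempty X
  continuous_smul : ∀ g : G, Continuous fun x : X => g • x
  minimal : ∀ x : X, Dense (Set.range fun g : G => g • x)
  proximal : ∀ x y : X, ∃ z : X,
    (z, z) ∈ closure {p : X × X | ∃ g : G, p = (g • x, g • y)}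

attribute [instance] MinimalProximalFlow.topX MinimalProximalFlow.mulAction

open Set Filter Topology

section MinimalProximal

variable {G X : Type*} [Group G] [TopologicalSpace X] [MulAction G X] [ContinuousConstSMul G X]

/-- In a minimal proximal flow, any two points can be moved simultaneously into any
nonempty open set. -/
theorem exists_smul_mem_and_smul_mem
    (hmin : ∀ x : X, Dense (range fun g : G => g • x))
    (hprox : ∀ x y : X, ∃ z : X, (z, z) ∈ closure {p : X × X | ∃ g : G, p = (g • x, g • y)})
    {W : Set X} (hW : IsOpen W) (hne : W.Nonempty) (x y : X) :
    ∃ g : G, g • x ∈ W ∧ g • y ∈ W := by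
  obtain ⟨z, hz⟩ := hprox x y
  obtain ⟨_, hh, h, rfl⟩ := (hmin z).inter_open_nonempty W hW hne
  have hV : IsOpen ((fun p : X => h • p) ⁻¹' W) := hW.preimage (continuous_const_smul h)
  obtain ⟨_, ⟨h1, h2⟩, g, rfl⟩ := mem_closure_iff.1 hz _ (hV.prod hV) ⟨hh, hh⟩
  exact ⟨h * g, by simpa [mul_smul] using h1, by simpa [mul_smul] using h2⟩

variable [CompactSpace X]

/-- In a compact minimal proximal flow, any finite set can be moved into any nonempty open set. -/
theorem Set.Finite.exists_smul_mem [Nonempty X]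
    (hmin : ∀ x : X, Dense (range fun g : G => g • x))
    (hprox : ∀ x y : X, ∃ z : X, (z, z) ∈ closure {p : X × X | ∃ g : G, p = (g • x, g • y)})
    {s : Set X} (hs : s.Finite) :
    ∀ {W : Set X}, IsOpen W → W.Nonempty → ∃ g : G, ∀ x ∈ s, g • x ∈ W := by
  induction s, hs using Set.Finite.induction_on with
  | empty => exact fun _ _ => ⟨1, by simp⟩
  | @insert a s _ _ ih =>
    intro W hW hne
    obtain ⟨z⟩ := ‹Nonempty X›
    choose h hz hw using exists_smul_mem_and_smul_mem hmin hprox hW hne z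
    have hV (w : X) : IsOpen ((fun p : X => h w • p) ⁻¹' W) :=
      hW.preimage (continuous_const_smul (h w))
    obtain ⟨t, -, ht⟩ := isCompact_univ.elim_nhds_subcover
      (fun w => (fun p : X => h w • p) ⁻¹' W) fun w _ => (hV w).mem_nhds (hw w)
    obtain ⟨g, hg⟩ := ih (W := ⋂ w ∈ t, (fun p : X => h w • p) ⁻¹' W)
      (isOpen_biInter_finset fun w _ => hV w) ⟨z, mem_iInter₂.2 fun w _ => hz w⟩
    obtain ⟨w, hwt, hgw⟩ := mem_iUnion₂.1 (ht (mem_univ (g • a)))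
    refine ⟨h w * g, fun x hx => ?_⟩
    rw [mul_smul]
    rcases hx with rfl | hx
    · exact hgw
    · exact mem_iInter₂.1 (hg x hx) w hwt

/-- If `l` converges to a point of a compact minimal proximal flow, then the elements of `G`
moving `l` into a given nonempty open set form a completely syndetic set. -/
theorem completelySyndetic_setOf_eventually_smul_mem
    (hmin : ∀ x : X, Dense (range fun g : G => g • x))
    (hprox : ∀ x y : X, ∃ z : X, (z, z) ∈ closure {p : X × X | ∃ g : G, p = (g • x, g • y)})
    {W : Set X} (hW : IsOpen W) (hne : W.Nonempty) {l : Filter X} {y : X} (hl : l ≤ 𝓝 y) :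
    CompletelySyndetic {g : G | ∀ᶠ p in l, g • p ∈ W} := by
  intro n _
  have : Nonempty X := ⟨y⟩
  have hV (g : G) : IsOpen ((fun p : X => g⁻¹ • p) ⁻¹' W) :=
    hW.preimage (continuous_const_smul g⁻¹)
  obtain ⟨F, hF⟩ := isCompact_univ.elim_finite_subcover
    (fun g : G => univ.pi fun _ : Fin n => (fun p : X => g⁻¹ • p) ⁻¹' W)
    (fun g => isOpen_set_pi finite_univ fun _ _ => hV g) (fun q _ => by
      obtain ⟨g, hg⟩ := (finite_range q).exists_smul_mem hmin hprox hW hne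
      exact mem_iUnion.2 ⟨g⁻¹, fun i _ => by simpa using hg (q i) ⟨i, rfl⟩⟩)
  refine ⟨F, fun x => ?_⟩
  obtain ⟨f, hf, hfx⟩ := mem_iUnion₂.1 (hF (mem_univ fun i => x i • y))
  refine ⟨f, hf, fun i => hl ?_⟩
  refine (hW.preimage (continuous_const_smul (f⁻¹ * x i))).mem_nhds ?_
  simpa [mul_smul] using hfx i (mem_univ i)

end MinimalProximal

theorem CompletelySyndetic.mono {G : Type*} [Group G] {A B : Set G} (h : CompletelySyndetic A)
    (hAB : A ⊆ B) : CompletelySyndetic B := fun n hn =>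
  let ⟨F, hF⟩ := h n hn
  ⟨F, fun x => let ⟨f, hf, hx⟩ := hF x; ⟨f, hf, fun i => hAB (hx i)⟩⟩

theorem CompletelySyndetic.nonempty {G : Type*} [Group G] {A : Set G}
    (h : CompletelySyndetic A) : A.Nonempty :=
  let ⟨_, hF⟩ := h 1 le_rfl
  let ⟨_, _, hx⟩ := hF fun _ => 1
  ⟨_, hx 0⟩

/-- A nontrivial compact Hausdorff minimal proximal flow yields a proper symmetrically completely
syndetic set: the elements moving a suitable ultrafilter, which contains all dense open sets, into
an open set that is neither empty nor dense. -/
theorem exists_symmetricallyCompletelySyndetic {G X : Type*} [Group G] [TopologicalSpace X]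
    [MulAction G X] [ContinuousConstSMul G X] [CompactSpace X] [T2Space X]
    (hmin : ∀ x : X, Dense (range fun g : G => g • x))
    (hprox : ∀ x y : X, ∃ z : X, (z, z) ∈ closure {p : X × X | ∃ g : G, p = (g • x, g • y)})
    {x y : X} (hxy : x ≠ y) :
    ∃ A : Set G, A ≠ univ ∧ SymmetricallyCompletelySyndetic A := by
  obtain ⟨U, V, hU, hV, hxU, hyV, hUV⟩ := t2_separation hxy
  have hVU : V ⊆ interior Uᶜ := hV.subset_interior_iff.2 hUV.subset_compl_left
  have : (𝓝 x ⊓ residual X).NeBot := by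
    refine inf_neBot_iff.2 fun {s} hs {t} ht => ?_
    exact (dense_of_mem_residual ht).inter_nhds_nonempty hs |>.mono fun _ h => h.symm
  obtain ⟨u, hu⟩ := Ultrafilter.exists_le (𝓝 x ⊓ residual X)
  have hux : (u : Filter X) ≤ 𝓝 x := hu.trans inf_le_left
  have hdense : Dense (U ∪ interior Uᶜ) := by
    intro p
    rw [closure_union, interior_compl]
    by_cases hp : p ∈ closure U
    · exact .inl hp
    · exact .inr (subset_closure hp)
  have hcompl (g : G) (hg : ¬ ∀ᶠ p in u, g • p ∈ U) : ∀ᶠ p in u, g • p ∈ interior Uᶜ := by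
    have h1 : (fun p : X => g • p) ⁻¹' (U ∪ interior Uᶜ) ∈ residual X :=
      residual_of_dense_open ((hU.union isOpen_interior).preimage (continuous_const_smul g))
        (hdense.preimage (isOpenMap_smul g))
    filter_upwards [hu (mem_inf_of_right h1), Ultrafilter.eventually_not.2 hg] with p hp hpU
    exact hp.resolve_left hpU
  have hcs {W : Set X} (hW : IsOpen W) (hne : W.Nonempty) :
      CompletelySyndetic {g : G | ∀ᶠ p in u, g • p ∈ W} :=
    completelySyndetic_setOf_eventually_smul_mem hmin hprox hW hne hux
  refine ⟨{g : G | ∀ᶠ p in u, g • p ∈ U}, ?_, hcs hU ⟨x, hxU⟩, fun F₁ F₂ => ?_⟩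
  · obtain ⟨g, hg⟩ := (hcs isOpen_interior ⟨y, hVU hyV⟩).nonempty
    refine ne_univ_iff_exists_notMem _ |>.2 ⟨g, fun h => ?_⟩
    obtain ⟨p, hp, hp'⟩ := (hg.and h).exists
    exact interior_subset hp hp'
  · refine (eq_empty_or_nonempty _).symm.imp_left ?_
    rintro ⟨a, ha₁, ha₂⟩
    let W : Set X := (⋂ f ∈ F₁, (fun p : X => f⁻¹ • p) ⁻¹' U) ∩
      ⋂ f ∈ F₂, (fun p : X => f⁻¹ • p) ⁻¹' interior Uᶜ
    have hW : IsOpen W := by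
      refine (isOpen_biInter_finset fun f _ => ?_).inter (isOpen_biInter_finset fun f _ => ?_)
      · exact hU.preimage (continuous_const_smul f⁻¹)
      · exact isOpen_interior.preimage (continuous_const_smul f⁻¹)
    have haW : ∀ᶠ p in u, a • p ∈ W := by
      have h₁ : ∀ᶠ p in u, ∀ f ∈ F₁, (f⁻¹ * a) • p ∈ U :=
        (eventually_all_finset F₁).2 fun f hf => mem_iInter₂.1 ha₁ f hf
      have h₂ : ∀ᶠ p in u, ∀ f ∈ F₂, (f⁻¹ * a) • p ∈ interior Uᶜ :=
        (eventually_all_finset F₂).2 fun f hf => hcompl _ (mem_iInter₂.1 ha₂ f hf)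
      filter_upwards [h₁, h₂] with p hp₁ hp₂
      exact ⟨mem_iInter₂.2 fun f hf => by simpa [mul_smul] using hp₁ f hf,
        mem_iInter₂.2 fun f hf => by simpa [mul_smul] using hp₂ f hf⟩
    obtain ⟨p, hp⟩ := haW.exists
    refine (hcs hW ⟨_, hp⟩).mono fun g hg => ⟨mem_iInter₂.2 fun f hf => ?_,
      mem_iInter₂.2 fun f hf h => ?_⟩
    · filter_upwards [hg] with p hp
      simpa [mul_smul] using mem_iInter₂.1 hp.1 f hf
    · obtain ⟨p, hp, hp'⟩ := (Eventually.and hg h).exists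
      have := interior_subset (mem_iInter₂.1 hp.2 f hf)
      exact this (by simpa [mul_smul] using hp')

theorem exists_finset_of_mem_nhds {G : Type*} {C : Set (G → Bool)} {z : C} {N : Set C} (hN : N ∈ 𝓝 z) :
    ∃ S : Finset G, ∀ η : C, (∀ h ∈ S, η.1 h = z.1 h) → η ∈ N := by
  obtain ⟨M, hM, hMN⟩ := mem_nhds_subtype C z N |>.1 hN
  obtain ⟨O, hOM, hO, hzO⟩ := mem_nhds_iff.1 hM
  obtain ⟨S, v, hv, hSO⟩ := isOpen_pi_iff.1 hO z.1 hzO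
  exact ⟨S, fun η hη => hMN (hOM (hSO fun h hh => (hη h hh).symm ▸ (hv h hh).2))⟩

section Shift

variable {G : Type*} [Group G]

/-- The right translate `h ↦ ω (h * x)` of a configuration `ω`. -/
def shift (x : G) (ω : G → Bool) : G → Bool := fun h => ω (h * x)

theorem continuous_shift (x : G) : Continuous (shift x) :=
  continuous_pi fun h => continuous_apply (h * x)

/-- The orbit closure of a configuration under the shift. -/
def shiftOrbitClosure (χ : G → Bool) : Set (G → Bool) := closure (range fun x => shift x χ)

theorem shift_mem_shiftOrbitClosure {χ ω : G → Bool} (x : G) (hω : ω ∈ shiftOrbitClosure χ) :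
    shift x ω ∈ shiftOrbitClosure χ := by
  refine map_mem_closure (continuous_shift x) hω ?_
  rintro _ ⟨y, rfl⟩
  exact ⟨x * y, funext fun h => by simp [shift, mul_assoc]⟩

instance (χ : G → Bool) : MulAction G (shiftOrbitClosure χ) where
  smul x ω := ⟨shift x ω, shift_mem_shiftOrbitClosure x ω.2⟩
  one_smul ω := Subtype.ext <| funext fun h => congrArg ω.1 (mul_one h)
  mul_smul x y ω := Subtype.ext <| funext fun h => congrArg ω.1 (mul_assoc h x y).symm

theorem coe_smul_apply {χ : G → Bool} (x : G) (ω : shiftOrbitClosure χ) (h : G) :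
    (x • ω).1 h = ω.1 (h * x) := rfl

theorem exists_forall_mem_eq {χ ω : G → Bool} (hω : ω ∈ shiftOrbitClosure χ) (S : Finset G) :
    ∃ x, ∀ h ∈ S, χ (h * x) = ω h := by
  have hO : IsOpen {η : G → Bool | ∀ h ∈ S, η h = ω h} := by
    have : {η : G → Bool | ∀ h ∈ S, η h = ω h} = ⋂ h ∈ S, (fun η => η h) ⁻¹' {ω h} := by
      ext; simp
    rw [this]
    exact isOpen_biInter_finset fun h _ => (isOpen_discrete _).preimage (continuous_apply h)
  obtain ⟨_, hx, x, rfl⟩ := mem_closure_iff.1 hω _ hO fun _ _ => rfl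
  exact ⟨x, hx⟩

open Classical in
/-- In the orbit closure of a symmetrically completely syndetic set, any two points can be moved
simultaneously arbitrarily close to any third point. -/
theorem SymmetricallyCompletelySyndetic.exists_smul_eq_on {A : Set G}
    (hA : SymmetricallyCompletelySyndetic A)
    (ω₁ ω₂ ω₀ : shiftOrbitClosure fun g => decide (g ∈ A)) (S : Finset G) :
    ∃ g : G, (∀ h ∈ S, (g • ω₁).1 h = ω₀.1 h) ∧ ∀ h ∈ S, (g • ω₂).1 h = ω₀.1 h := by
  set R : Set G := {x | ∀ h ∈ S, decide (h * x ∈ A) = ω₀.1 h} with hR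
  have hRcs : CompletelySyndetic R := by
    obtain ⟨a, ha⟩ := exists_forall_mem_eq ω₀.2 S
    have hR' : (⋂ f ∈ (S.filter fun h => ω₀.1 h = true).image (·⁻¹), {x : G | f⁻¹ * x ∈ A}) ∩
        (⋂ f ∈ (S.filter fun h => ω₀.1 h = false).image (·⁻¹), {x : G | f⁻¹ * x ∈ Aᶜ}) = R := by
      ext x
      simp only [mem_inter_iff, mem_iInter, Finset.mem_image, Finset.mem_filter, mem_ofPred_eq,
        forall_exists_index, and_imp, mem_compl_iff, hR]
      constructor
      · rintro ⟨h₁, h₂⟩ h hh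
        cases hω : ω₀.1 h
        · simpa using h₂ _ h hh hω rfl
        · simpa using h₁ _ h hh hω rfl
      · intro H
        exact ⟨fun _ h hh hω e => by subst e; simpa [hω] using H h hh,
          fun _ h hh hω e => by subst e; simpa [hω] using H h hh⟩
    have := hA.2 ((S.filter fun h => ω₀.1 h = true).image (·⁻¹))
      ((S.filter fun h => ω₀.1 h = false).image (·⁻¹))
    rw [hR'] at this
    exact this.resolve_right (nonempty_iff_ne_empty.1 ⟨a, ha⟩)
  obtain ⟨F, hF⟩ := hRcs 2 (by norm_num)
  let T : Finset G := (S ×ˢ F).image fun p => p.1 * p.2⁻¹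
  have hT {h f : G} (hh : h ∈ S) (hf : f ∈ F) : h * f⁻¹ ∈ T :=
    Finset.mem_image.2 ⟨(h, f), Finset.mem_product.2 ⟨hh, hf⟩, rfl⟩
  obtain ⟨x₁, hx₁⟩ := exists_forall_mem_eq ω₁.2 T
  obtain ⟨x₂, hx₂⟩ := exists_forall_mem_eq ω₂.2 T
  obtain ⟨f, hf, hfx⟩ := hF ![x₁, x₂]
  refine ⟨f⁻¹, fun h hh => ?_, fun h hh => ?_⟩
  · rw [coe_smul_apply, ← hx₁ _ (hT hh hf), ← hfx 0 h hh]
    exact decide_eq_decide.2 (by simp [mul_assoc])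
  · rw [coe_smul_apply, ← hx₂ _ (hT hh hf), ← hfx 1 h hh]
    exact decide_eq_decide.2 (by simp [mul_assoc])

end Shift

open Classical in
/-- The orbit closure of a symmetrically completely syndetic set under the shift. -/
noncomputable def SymmetricallyCompletelySyndetic.flow {G : Type u} [Group G] {A : Set G}
    (hA : SymmetricallyCompletelySyndetic A) : MinimalProximalFlow G where
  X := shiftOrbitClosure fun g => decide (g ∈ A)
  compact := isCompact_iff_compactSpace.1 isClosed_closure.isCompact
  t2 := inferInstance
  nonempty := ⟨⟨_, subset_closure ⟨1, rfl⟩⟩⟩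
  continuous_smul g := ((continuous_shift g).comp continuous_subtype_val).subtype_mk _
  minimal ω z := mem_closure_iff_nhds.2 fun N hN => by
    obtain ⟨S, hS⟩ := exists_finset_of_mem_nhds hN
    obtain ⟨g, hg, -⟩ := hA.exists_smul_eq_on ω ω z S
    exact ⟨g • ω, hS _ hg, g, rfl⟩
  proximal ω₁ ω₂ := ⟨ω₁, mem_closure_iff_nhds.2 fun N hN => by
    obtain ⟨N₁, hN₁, N₂, hN₂, hN⟩ := mem_nhds_prod_iff.1 hN
    obtain ⟨S, hS⟩ := exists_finset_of_mem_nhds (inter_mem hN₁ hN₂)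
    obtain ⟨g, hg₁, hg₂⟩ := hA.exists_smul_eq_on ω₁ ω₂ ω₁ S
    exact ⟨(g • ω₁, g • ω₂), hN ⟨(hS _ hg₁).1, (hS _ hg₂).2⟩, g, rfl⟩⟩

/-- `G` is not strongly amenable (some minimal proximal `G`-flow has at least two points)
iff `G` contains a proper symmetrically completely syndetic subset. -/
theorem not_stronglyAmenable_iff_symmetricallyCompletelySyndetic {G : Type u} [Group G] :
    (∃ P : MinimalProximalFlow G, ∃ x y : P.X, x ≠ y) ↔
      ∃ A : Set G, A ≠ Set.univ ∧ SymmetricallyCompletelySyndetic A := by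
  classical
  constructor
  · rintro ⟨P, x, y, hxy⟩
    have := P.compact
    have := P.t2
    have : ContinuousConstSMul G P.X := ⟨P.continuous_smul⟩
    exact exists_symmetricallyCompletelySyndetic P.minimal P.proximal hxy
  · rintro ⟨A, hne, hA⟩
    obtain ⟨a, ha⟩ := hA.1.nonempty
    obtain ⟨b, hb⟩ := (ne_univ_iff_exists_notMem A).1 hne
    refine ⟨hA.flow, ⟨_, subset_closure ⟨a, rfl⟩⟩, ⟨_, subset_closure ⟨b, rfl⟩⟩, fun h => hb ?_⟩
    simpa [shift, ha] using congrFun (congrArg Subtype.val h) 1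
end

section
/- Let G be a group. A subset A ⊆ G is a dense orbit set if and only if there is no symmetrically syndetic subset B ⊆ G with B ⊆ G ∖ A. -/
/-- A subset `A` of a group `G` is syndetic if finitely many left translates of `A`
cover `G`, i.e. there is a finite `F ⊆ G` with `⋃_{f ∈ F} f·A = G`. -/
def SyndeticSet {G : Type*} [Group G] (A : Set G) : Prop :=
  ∃ F : Finset G, ∀ g : G, ∃ f ∈ F, f⁻¹ * g ∈ A

/-- `A ⊆ G` is symmetrically syndetic if it is syndetic and for all finite `F₁, F₂ ⊆ G`
the set `(⋂_{f ∈ F₁} f·A) ∩ (⋂_{f ∈ F₂} f·Aᶜ)` is either syndetic or empty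
(here `f·A = {x : f⁻¹ x ∈ A}`). -/
def SymmetricallySyndetic {G : Type*} [Group G] (A : Set G) : Prop :=
  SyndeticSet A ∧ ∀ F₁ F₂ : Finset G,
    SyndeticSet ((⋂ f ∈ F₁, {x : G | f⁻¹ * x ∈ A}) ∩ (⋂ f ∈ F₂, {x : G | f⁻¹ * x ∈ Aᶜ})) ∨
    ((⋂ f ∈ F₁, {x : G | f⁻¹ * x ∈ A}) ∩ (⋂ f ∈ F₂, {x : G | f⁻¹ * x ∈ Aᶜ})) = ∅

/-- `A ⊆ G` is a dense orbit set if for every minimal `G`-flow `X` (nonempty compact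
Hausdorff, `G` acting by homeomorphisms, all orbits dense) and every `x ∈ X`, the set
`A • x` is dense in `X`. -/
def DenseOrbitSet {G : Type u} [Group G] (A : Set G) : Prop :=
  ∀ (X : Type u) [TopologicalSpace X] [MulAction G X],
    CompactSpace X → T2Space X → Nonempty X →
    (∀ g : G, Continuous fun x : X => g • x) →
    (∀ x : X, Dense (Set.range fun g : G => g • x)) →
    ∀ x : X, Dense {y : X | ∃ g ∈ A, y = g • x}

open MulAction in
/-- In a compact minimal flow, return times to a nonempty open set form a syndetic set. -/
theorem syndeticSet_returnTimes {G X : Type*} [Group G] [TopologicalSpace X] [MulAction G X]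
    [CompactSpace X] [ContinuousConstSMul G X] [IsMinimal G X] {U : Set X} (hU : IsOpen U)
    (hne : U.Nonempty) (x : X) : SyndeticSet {g : G | g • x ∈ U} := by
  obtain ⟨F, hF⟩ := isCompact_univ.exists_finite_cover_smul G hU hne
  refine ⟨F, fun g => ?_⟩
  obtain ⟨f, hf, hgf⟩ := Set.mem_iUnion₂.1 (hF (Set.mem_univ (g • x)))
  refine ⟨f, hf, ?_⟩
  simpa [mul_smul] using Set.mem_smul_set_iff_inv_smul_mem.1 hgf

open MulAction in
/-- In a compact minimal flow, return times to a nonempty clopen set form a symmetrically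
syndetic set. -/
theorem symmetricallySyndetic_returnTimes {G X : Type*} [Group G] [TopologicalSpace X]
    [MulAction G X] [CompactSpace X] [ContinuousConstSMul G X] [IsMinimal G X] {V : Set X}
    (hV : IsClopen V) (hne : V.Nonempty) (x : X) :
    SymmetricallySyndetic {g : G | g • x ∈ V} := by
  refine ⟨syndeticSet_returnTimes hV.isOpen hne x, fun F₁ F₂ => ?_⟩
  let W : Set X := (⋂ f ∈ F₁, (fun y : X => f⁻¹ • y) ⁻¹' V) ∩
    (⋂ f ∈ F₂, (fun y : X => f⁻¹ • y) ⁻¹' Vᶜ)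
  have hW : IsOpen W :=
    (isOpen_biInter_finset fun f _ => hV.isOpen.preimage (continuous_const_smul f⁻¹)).inter
      (isOpen_biInter_finset fun f _ => hV.compl.isOpen.preimage (continuous_const_smul f⁻¹))
  have hEq : (⋂ f ∈ F₁, {g : G | f⁻¹ * g ∈ {g : G | g • x ∈ V}}) ∩
      (⋂ f ∈ F₂, {g : G | f⁻¹ * g ∈ {g : G | g • x ∈ V}ᶜ}) = {g : G | g • x ∈ W} := by
    ext g
    simp [W, mul_smul]
  rw [hEq]
  rcases W.eq_empty_or_nonempty with h | h
  · right
    simp [h]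
  · exact Or.inl (syndeticSet_returnTimes hW h x)

open MulAction in
/-- Every nonempty compact flow contains a closed minimal subflow. -/
theorem exists_isClosed_isMinimal_subMulAction (G X : Type*) [Group G] [TopologicalSpace X]
    [MulAction G X] [CompactSpace X] [Nonempty X] [ContinuousConstSMul G X] :
    ∃ M : SubMulAction G X, IsClosed (M : Set X) ∧ (M : Set X).Nonempty ∧ IsMinimal G M := by
  let S : Set (Set X) := {s | IsClosed s ∧ s.Nonempty ∧ ∀ (g : G), ∀ y ∈ s, g • y ∈ s}
  obtain ⟨m, -, hm⟩ := zorn_superset_nonempty S (fun c hc hchain hne => by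
    refine ⟨⋂₀ c, ⟨isClosed_sInter fun s hs => (hc hs).1, ?_, fun g y hy s hs =>
      (hc hs).2.2 g y (hy s hs)⟩, fun s hs => Set.sInter_subset_of_mem hs⟩
    have := hne.to_subtype
    rw [Set.sInter_eq_iInter]
    exact IsCompact.nonempty_iInter_of_directed_nonempty_isCompact_isClosed _
      (fun s t => (hchain.total s.2 t.2).elim (fun h => ⟨s, subset_rfl, h⟩)
        fun h => ⟨t, h, subset_rfl⟩)
      (fun s => (hc s.2).2.1) (fun s => (hc s.2).1.isCompact) (fun s => (hc s.2).1))
    Set.univ ⟨isClosed_univ, Set.univ_nonempty, fun _ _ _ => Set.mem_univ _⟩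
  obtain ⟨hcl, hne, hinv⟩ := hm.prop
  refine ⟨⟨m, fun g _ hy => hinv g _ hy⟩, hcl, hne, ⟨fun y => ?_⟩⟩
  have hcont : ∀ g : G, Continuous fun z : X => g • z := continuous_const_smul
  have hsub : m ⊆ closure (orbit G (y : X)) := by
    refine hm.le_of_le ⟨isClosed_closure, ⟨y, subset_closure (mem_orbit_self _)⟩, ?_⟩ ?_
    · intro g z hz
      exact map_mem_closure (hcont g) hz fun w hw => mem_orbit_of_mem_orbit g hw
    · refine closure_minimal ?_ hcl
      rintro _ ⟨g, rfl⟩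
      exact hinv g _ y.2
  intro z
  rw [closure_subtype]
  refine closure_mono ?_ (hsub z.2)
  rintro _ ⟨g, rfl⟩
  exact ⟨g • y, mem_orbit _ _, rfl⟩

open MulAction in
/-- If a point returns syndetically to arbitrarily small closed neighbourhoods of itself, then
its orbit closure is minimal. -/
theorem dense_orbit_of_syndeticSet_returnTimes {G X : Type*} [Group G] [TopologicalSpace X]
    [MulAction G X] [ContinuousConstSMul G X] {b : X}
    (hb : ∀ U ∈ nhds b, ∃ K ⊆ U, IsClosed K ∧ SyndeticSet {g : G | g • b ∈ K})
    {y : X} (hy : y ∈ closure (orbit G b)) : closure (orbit G b) ⊆ closure (orbit G y) := by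
  have hcont : ∀ g : G, Continuous fun z : X => g • z := continuous_const_smul
  have hby : b ∈ closure (orbit G y) := by
    rw [mem_closure_iff_nhds]
    intro U hU
    obtain ⟨K, hKU, hK, F, hF⟩ := hb U hU
    have hcl : IsClosed (⋃ f ∈ F, (fun z : X => f⁻¹ • z) ⁻¹' K) :=
      F.finite_toSet.isClosed_biUnion fun f _ => hK.preimage (hcont f⁻¹)
    have hsub : closure (orbit G b) ⊆ ⋃ f ∈ F, (fun z : X => f⁻¹ • z) ⁻¹' K := by
      refine closure_minimal ?_ hcl
      rintro _ ⟨g, rfl⟩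
      obtain ⟨f, hf, hg⟩ := hF g
      refine Set.mem_iUnion₂.2 ⟨f, hf, ?_⟩
      simpa [mul_smul] using hg
    obtain ⟨f, -, hf⟩ := Set.mem_iUnion₂.1 (hsub hy)
    exact ⟨f⁻¹ • y, hKU hf, mem_orbit _ _⟩
  refine closure_minimal ?_ isClosed_closure
  rintro _ ⟨g, rfl⟩
  exact map_mem_closure (hcont g) hby fun w hw => mem_orbit_of_mem_orbit g hw

/-- The action of `G` on the Bernoulli shift `G → Bool` by right translation of the argument. -/
abbrev shiftAction (G : Type*) [Group G] : MulAction G (G → Bool) where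
  smul g z := fun h => z (h * g)
  one_smul z := funext fun h => congrArg z (mul_one h)
  mul_smul g k z := funext fun h => congrArg z (mul_assoc h g k).symm

/-- The action of `G` by left translation on the Stone–Čech compactification of the discrete
group `G`. -/
abbrev ultrafilterAction (G : Type*) [Group G] : MulAction G (Ultrafilter G) where
  smul g p := p.map (g * ·)
  one_smul p := by
    change p.map (1 * ·) = p
    simp
  mul_smul g k p := by
    change p.map (g * k * ·) = (p.map (k * ·)).map (g * ·)
    rw [Ultrafilter.map_map]
    congr 1
    funext h
    exact mul_assoc g k h

/-- The return times of the indicator function of a symmetrically syndetic set to a cylinder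
around it form a syndetic set. -/
theorem SymmetricallySyndetic.syndeticSet_cylinder {G : Type*} [Group G] {B : Set G}
    (hB : SymmetricallySyndetic B) (S : Finset G) :
    SyndeticSet {g : G | ∀ s ∈ S, (s * g ∈ B ↔ s ∈ B)} := by
  classical
  have hEq : (⋂ f ∈ (S.filter (· ∈ B)).image (·⁻¹), {x : G | f⁻¹ * x ∈ B}) ∩
      (⋂ f ∈ (S.filter (· ∉ B)).image (·⁻¹), {x : G | f⁻¹ * x ∈ Bᶜ}) =
      {g : G | ∀ s ∈ S, (s * g ∈ B ↔ s ∈ B)} := by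
    ext g
    simp only [Set.mem_inter_iff, Set.mem_iInter, Set.mem_ofPred_eq, Finset.mem_image,
      Finset.mem_filter, Set.mem_compl_iff, forall_exists_index, and_imp]
    constructor
    · rintro ⟨h₁, h₂⟩ s hs
      by_cases hsB : s ∈ B
      · simpa [hsB] using h₁ _ s hs hsB rfl
      · simpa [hsB] using h₂ _ s hs hsB rfl
    · intro h
      constructor
      · rintro _ s hs hsB rfl
        simpa [hsB] using h s hs
      · rintro _ s hs hsB rfl
        simpa [hsB] using h s hs
  rw [← hEq]
  refine (hB.2 _ _).resolve_right ?_
  rw [hEq]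
  exact Set.Nonempty.ne_empty ⟨1, fun s _ => by simp⟩

open MulAction in
/-- A dense orbit set meets every symmetrically syndetic set. -/
theorem DenseOrbitSet.inter_nonempty {G : Type u} [Group G] {A B : Set G}
    (hA : DenseOrbitSet A) (hB : SymmetricallySyndetic B) : (A ∩ B).Nonempty := by
  classical
  let _ := shiftAction G
  have hcont : ∀ g : G, Continuous fun z : G → Bool => g • z := fun g =>
    continuous_pi fun h => continuous_apply (h * g)
  have : ContinuousConstSMul G (G → Bool) := ⟨hcont⟩
  let b : G → Bool := fun g => decide (g ∈ B)
  let X : SubMulAction G (G → Bool) := ⟨closure (orbit G b), fun g _ hz =>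
    map_mem_closure (hcont g) hz fun w hw => mem_orbit_of_mem_orbit g hw⟩
  have hb : ∀ U ∈ nhds b, ∃ K ⊆ U, IsClosed K ∧ SyndeticSet {g : G | g • b ∈ K} := by
    intro U hU
    rw [nhds_pi, Filter.mem_pi] at hU
    obtain ⟨I, hI, t, ht, htU⟩ := hU
    refine ⟨{z | ∀ s ∈ hI.toFinset, z s = b s}, fun z hz => htU fun s hs => ?_, ?_, ?_⟩
    · rw [hz s (hI.mem_toFinset.2 hs)]
      exact mem_of_mem_nhds (ht s)
    · simp only [Set.ofPred_forall]
      exact isClosed_biInter fun s _ => isClosed_eq (continuous_apply s) continuous_const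
    · have hEq : {g : G | g • b ∈ {z : G → Bool | ∀ s ∈ hI.toFinset, z s = b s}} =
          {g : G | ∀ s ∈ hI.toFinset, (s * g ∈ B ↔ s ∈ B)} :=
        Set.ext fun g => forall₂_congr fun s _ => decide_eq_decide
      exact hEq ▸ hB.syndeticSet_cylinder hI.toFinset
  have hX : IsClosed (X : Set (G → Bool)) := isClosed_closure
  have hXb : b ∈ X := subset_closure (mem_orbit_self b)
  have hdense := hA X (isCompact_iff_compactSpace.1 hX.isCompact) inferInstance ⟨⟨b, hXb⟩⟩
    (fun g => ((hcont g).comp continuous_subtype_val).subtype_mk _)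
    (fun y z => by
      rw [closure_subtype]
      refine closure_mono ?_ (dense_orbit_of_syndeticSet_returnTimes hb y.2 z.2)
      rintro _ ⟨g, rfl⟩
      exact ⟨g • y, ⟨g, rfl⟩, rfl⟩) ⟨b, hXb⟩
  obtain ⟨F, hF⟩ := hB.1
  obtain ⟨f, -, hf⟩ := hF 1
  have hopen : IsOpen {z : X | (z : G → Bool) 1 = true} :=
    (isOpen_discrete ({true} : Set Bool)).preimage
      ((continuous_apply (1 : G)).comp (continuous_subtype_val (p := (· ∈ X))))
  have key : ∀ g : G, (g • b) 1 = true ↔ g ∈ B := fun g => by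
    change decide (1 * g ∈ B) = true ↔ g ∈ B
    simp
  obtain ⟨_, hz, g, hg, rfl⟩ := hdense.inter_open_nonempty _ hopen
    ⟨(f⁻¹ * 1) • ⟨b, hXb⟩, (key _).2 hf⟩
  exact ⟨g, hg, (key g).1 hz⟩

open MulAction in
/-- In every minimal flow, the return times of a point to a nonempty open set contain a
symmetrically syndetic set. -/
theorem exists_symmetricallySyndetic_subset_returnTimes {G X : Type*} [Group G]
    [TopologicalSpace X] [MulAction G X] [CompactSpace X] [T2Space X] [ContinuousConstSMul G X]
    [IsMinimal G X] (x : X) {U : Set X} (hU : IsOpen U) (hne : U.Nonempty) :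
    ∃ B : Set G, SymmetricallySyndetic B ∧ B ⊆ {g : G | g • x ∈ U} := by
  let _ := ultrafilterAction G
  have : ContinuousConstSMul G (Ultrafilter G) := ⟨fun g => by
    refine continuous_generateFrom_iff.2 ?_
    rintro _ ⟨s, rfl⟩
    exact ultrafilter_isOpen_basic ((g * ·) ⁻¹' s)⟩
  obtain ⟨M, hM, ⟨p₀, hp₀⟩, hmin⟩ := exists_isClosed_isMinimal_subMulAction G (Ultrafilter G)
  let φ : Ultrafilter G → X := Ultrafilter.extend fun g : G => g • x
  have hφ : Continuous φ := continuous_ultrafilter_extend _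
  have hequiv : ∀ (g : G) (p : Ultrafilter G), φ (g • p) = g • φ p := by
    intro g p
    refine ultrafilter_extend_eq_iff.2 ?_
    have h := ultrafilter_extend_eq_iff.1 (rfl : φ p = φ p)
    have h' : Filter.Tendsto (fun k : G => k • x) p (nhds (φ p)) := h
    have h'' := h'.const_smul g
    simp only [smul_smul] at h''
    exact h''
  have himage : φ '' (M : Set (Ultrafilter G)) = Set.univ := by
    refine (eq_empty_or_univ_of_smul_invariant_closed G (hM.isCompact.image hφ).isClosed
      ?_).resolve_left (Set.Nonempty.ne_empty ⟨_, p₀, hp₀, rfl⟩)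
    rintro g _ ⟨_, ⟨p, hp, rfl⟩, rfl⟩
    exact ⟨g • p, M.smul_mem g hp, hequiv g p⟩
  have : CompactSpace M := isCompact_iff_compactSpace.1 hM.isCompact
  have : ContinuousConstSMul G M :=
    ⟨fun g => ((continuous_const_smul g).comp continuous_subtype_val).subtype_mk _⟩
  have hsurj : ∀ y : X, ∃ p : M, φ p = y := fun y => by
    obtain ⟨p, hp, rfl⟩ := himage.ge (Set.mem_univ y)
    exact ⟨⟨p, hp⟩, rfl⟩
  obtain ⟨u, hu⟩ := hne
  obtain ⟨q, rfl⟩ := hsurj u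
  obtain ⟨p, hp⟩ := hsurj x
  obtain ⟨V, hV, hqV, hVU⟩ := compact_exists_isClopen_in_isOpen
    (hU.preimage (hφ.comp continuous_subtype_val)) (x := q) hu
  refine ⟨_, symmetricallySyndetic_returnTimes hV ⟨q, hqV⟩ p, fun g hg => ?_⟩
  simpa [hequiv, hp] using hVU hg

/-- `A ⊆ G` is a dense orbit set iff no symmetrically syndetic subset is contained in its
complement. -/
theorem denseOrbitSet_iff {G : Type u} [Group G] (A : Set G) :
    DenseOrbitSet A ↔ ¬ ∃ B : Set G, SymmetricallySyndetic B ∧ B ⊆ Aᶜ := by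
  constructor
  · rintro hA ⟨B, hB, hBA⟩
    obtain ⟨g, hgA, hgB⟩ := hA.inter_nonempty hB
    exact hBA hgB hgA
  · intro h X _ _ _ _ _ hcont hmin x
    have : ContinuousConstSMul G X := ⟨hcont⟩
    have : MulAction.IsMinimal G X := ⟨hmin⟩
    refine dense_iff_inter_open.2 fun U hU hne => ?_
    by_contra hempty
    obtain ⟨B, hB, hBU⟩ := exists_symmetricallySyndetic_subset_returnTimes (G := G) x hU hne
    exact h ⟨B, hB, fun g hgB hgA => hempty ⟨g • x, hBU hgB, g, hgA, rfl⟩⟩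
end

section
/- Let G be a group and let A ⊆ G be nonempty. Then A is symmetrically syndetic if and only if for every pair of finite subsets F₁ ⊆ A and F₂ ⊆ G ∖ A, the set (⋂_{f ∈ F₁} f⁻¹·A) ∩ (⋂_{f ∈ F₂} f⁻¹·Aᶜ) is syndetic, where f⁻¹·S = {f⁻¹·s : s ∈ S} and an intersection over the empty index set equals G. -/
theorem SyndeticSet.of_preimage_mul_left {G : Type*} [Group G] {S : Set G} (y : G)
    (h : SyndeticSet {x : G | y * x ∈ S}) : SyndeticSet S := by
  classical
  obtain ⟨F, hF⟩ := h
  refine ⟨F.image (· * y⁻¹), fun g => ?_⟩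
  obtain ⟨f, hf, hfg⟩ := hF g
  exact ⟨f * y⁻¹, Finset.mem_image_of_mem _ hf, by simpa [mul_assoc] using hfg⟩

/-- A nonempty `A ⊆ G` is symmetrically syndetic iff for every pair of finite subsets
`F₁ ⊆ A` and `F₂ ⊆ Aᶜ`, the set `(⋂_{f ∈ F₁} f⁻¹·A) ∩ (⋂_{f ∈ F₂} f⁻¹·Aᶜ)` is syndetic
(here `f⁻¹·A = {x : f·x ∈ A}`). -/
theorem symmetricallySyndetic_iff {G : Type*} [Group G] (A : Set G) (hA : A.Nonempty) :
    SymmetricallySyndetic A ↔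
      ∀ F₁ F₂ : Finset G, ↑F₁ ⊆ A → ↑F₂ ⊆ Aᶜ →
        SyndeticSet
          ((⋂ f ∈ F₁, {x : G | f * x ∈ A}) ∩ (⋂ f ∈ F₂, {x : G | f * x ∈ Aᶜ})) := by
  classical
  constructor
  · rintro ⟨-, h⟩ F₁ F₂ h₁ h₂
    have key := h (F₁.image (·⁻¹)) (F₂.image (·⁻¹))
    simp only [Finset.set_biInter_finset_image, inv_inv] at key
    refine key.resolve_right (Set.Nonempty.ne_empty ⟨1, ?_⟩)
    simp only [Set.mem_inter_iff, Set.mem_iInter, Set.mem_ofPred_eq, mul_one]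
    exact ⟨fun f hf => h₁ hf, fun f hf => h₂ hf⟩
  · intro h
    refine ⟨?_, fun F₁ F₂ => ?_⟩
    · obtain ⟨a, ha⟩ := hA
      have key := h {a} ∅ (by simpa using ha) (by simp)
      exact .of_preimage_mul_left a (by simpa using key)
    · refine (Set.eq_empty_or_nonempty _).symm.imp_left ?_
      rintro ⟨y, hy₁, hy₂⟩
      simp only [Set.mem_iInter, Set.mem_ofPred_eq] at hy₁ hy₂
      refine .of_preimage_mul_left y ?_
      convert h (F₁.image (·⁻¹ * y)) (F₂.image (·⁻¹ * y)) ?_ ?_ using 1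
      · ext x
        simp [mul_assoc]
      · simpa [Set.subset_def] using hy₁
      · simpa [Set.subset_def] using hy₂
end
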